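/- arXiv:2303.03536 — 11 statements merged into one kernel-verified Lean document; each statement's English description precedes it below -/
import Mathlib

section
/- Let f : ℝ^n → ℝ be continuously differentiable, bounded below, such that the set of critical values {f(x) : x ∈ ℝ^n, ∇f(x) = 0} is finite, and such that for every x₀ ∈ ℝ^n there exists a bounded gradient trajectory of f starting at x₀ (i.e. a differentiable curve x : [0,∞) → ℝ^n with x(0) = x₀, x'(t) = −∇f(x(t)) for all t ≥ 0, and ‖x(t)‖ ≤ r for all t ≥ 0 for some r > 0). Then every local minimum of f is a global minimum if and only if every setwise local minimum of f is a setwise global minimum. -/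
open Set

/-- A nonempty closed set `S` is a *setwise local minimum* of `f`. -/
def SetwiseLocalMin {E : Type*} [TopologicalSpace E] (f : E → ℝ) (S : Set E) : Prop :=
  S.Nonempty ∧ IsClosed S ∧ ∃ U : Set E, IsOpen U ∧ S ⊆ U ∧ ∀ x ∈ S, ∀ y ∈ U \ S, f x ≤ f y

open Filter Topology

section GradientCurves

variable {E : Type*} [NormedAddCommGroup E] [InnerProductSpace ℝ E] [CompleteSpace E]
  {f : E → ℝ} {x : ℝ → E}

/-- Along a gradient curve the derivative of `f` is minus the squared norm of the gradient. -/
theorem hasDerivWithinAt_comp_gradient_curve (hf : Differentiable ℝ f)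
    (hx : ∀ t ≥ (0 : ℝ), HasDerivWithinAt x (-gradient f (x t)) (Ici 0) t) {t : ℝ} (ht : 0 ≤ t) :
    HasDerivWithinAt (fun s => f (x s)) (-‖gradient f (x t)‖ ^ 2) (Ici 0) t := by
  have h := (hf (x t)).hasGradientAt.hasFDerivAt.comp_hasDerivWithinAt t (hx t ht)
  rw [map_neg, InnerProductSpace.toDual_apply_apply, real_inner_self_eq_norm_sq] at h
  exact h

theorem antitoneOn_comp_gradient_curve (hf : Differentiable ℝ f)
    (hx : ∀ t ≥ (0 : ℝ), HasDerivWithinAt x (-gradient f (x t)) (Ici 0) t) :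
    AntitoneOn (fun s => f (x s)) (Ici 0) := by
  refine antitoneOn_of_hasDerivWithinAt_nonpos (f' := fun t => -‖gradient f (x t)‖ ^ 2)
    (convex_Ici 0) (fun t ht => (hasDerivWithinAt_comp_gradient_curve hf hx ht).continuousWithinAt)
    (fun t ht => ?_) (fun t _ => by simp)
  exact (hasDerivWithinAt_comp_gradient_curve hf hx (interior_subset ht)).mono interior_subset

/-- A gradient curve is constant on every interval along which `f` does not decrease. -/
theorem gradient_curve_eq_of_le (hf : Differentiable ℝ f)
    (hx : ∀ t ≥ (0 : ℝ), HasDerivWithinAt x (-gradient f (x t)) (Ici 0) t)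
    {a b : ℝ} (ha : 0 ≤ a) (hab : a ≤ b) (hle : f (x a) ≤ f (x b)) : x b = x a := by
  have hanti := antitoneOn_comp_gradient_curve hf hx
  have hconst : ∀ s ∈ Icc a b, f (x s) = f (x a) := fun s hs =>
    le_antisymm (hanti ha (ha.trans hs.1) hs.1)
      (hle.trans (hanti (ha.trans hs.1) (ha.trans hab) hs.2))
  refine constant_of_has_deriv_right_zero (fun s hs => ?_) (fun s hs => ?_) b ⟨hab, le_rfl⟩
  · exact (hx s (ha.trans hs.1)).continuousWithinAt.mono fun u hu => ha.trans hu.1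
  · have hs0 : 0 ≤ s := ha.trans hs.1
    have hsub : Ici s ⊆ Ici 0 := Ici_subset_Ici.2 hs0
    have h1 := (hasDerivWithinAt_comp_gradient_curve hf hx hs0).mono hsub
    have h2 : HasDerivWithinAt (fun u => f (x u)) 0 (Ici s) s := by
      refine (hasDerivWithinAt_const s (Ici s) (f (x a))).congr_of_eventuallyEq ?_
        (hconst s ⟨hs.1, hs.2.le⟩)
      filter_upwards [Icc_mem_nhdsGE hs.2] with u hu
      exact hconst u ⟨hs.1.trans hu.1, hu.2⟩
    have h3 := (uniqueDiffWithinAt_Ici s).eq_deriv _ h1 h2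
    have h4 : gradient f (x s) = 0 := by simpa using h3
    simpa [h4] using (hx s hs0).mono hsub

/-- A gradient curve that starts in a setwise local minimum stays in it. -/
theorem SetwiseLocalMin.gradient_curve_mem {S : Set E} (hS : SetwiseLocalMin f S)
    (hf : Differentiable ℝ f)
    (hx : ∀ t ≥ (0 : ℝ), HasDerivWithinAt x (-gradient f (x t)) (Ici 0) t)
    (h0 : x 0 ∈ S) {t : ℝ} (ht : 0 ≤ t) : x t ∈ S := by
  obtain ⟨-, hclosed, U, hU, hSU, hmin⟩ := hS
  have hcont : ContinuousOn x (Ici 0) := fun s hs => (hx s hs).continuousWithinAt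
  have hcl : IsClosed (x ⁻¹' S ∩ Icc 0 t) := by
    rw [inter_comm]
    exact (hcont.mono Icc_subset_Ici_self).preimage_isClosed_of_isClosed isClosed_Icc hclosed
  refine hcl.Icc_subset_of_forall_exists_gt h0 (fun s hs y hy => ?_) ⟨ht, le_rfl⟩
  have hs0 : 0 ≤ s := hs.2.1
  have hmemU : ∀ᶠ u in 𝓝[>] s, x u ∈ U :=
    ((hcont s hs0).mono (Ioi_subset_Ici hs0)) (hU.mem_nhds (hSU hs.1))
  obtain ⟨u, huU, hu⟩ := (hmemU.and (Ioc_mem_nhdsGT hy)).exists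
  refine ⟨u, ?_, hu⟩
  by_contra huS
  exact huS (by
    simpa only [mem_preimage, gradient_curve_eq_of_le hf hx hs0 hu.1.le
      (hmin _ hs.1 _ ⟨huU, huS⟩)] using hs.1)

/-- A bounded gradient curve in a closed set has a critical point of no larger value there. -/
theorem exists_critical_le_of_bounded_gradient_curve [ProperSpace E] (hf : ContDiff ℝ 1 f)
    (hbdd : BddBelow (range f))
    (hx : ∀ t ≥ (0 : ℝ), HasDerivWithinAt x (-gradient f (x t)) (Ici 0) t)
    {r : ℝ} (hr : ∀ t ≥ (0 : ℝ), ‖x t‖ ≤ r) {S : Set E} (hS : IsClosed S)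
    (hmem : ∀ t ≥ (0 : ℝ), x t ∈ S) :
    ∃ p ∈ S, gradient f p = 0 ∧ f p ≤ f (x 0) := by
  have hd : Differentiable ℝ f := hf.differentiable one_ne_zero
  have hanti := antitoneOn_comp_gradient_curve hd hx
  have hder := fun t (ht : 0 ≤ t) => hasDerivWithinAt_comp_gradient_curve hd hx ht
  have hmvt : ∀ k : ℕ, ∃ t : ℝ, 0 ≤ t ∧
      ‖gradient f (x t)‖ ^ 2 = f (x k) - f (x (k + 1 : ℕ)) := fun k => by
    have hk : (0 : ℝ) ≤ k := k.cast_nonneg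
    obtain ⟨t, ht, h⟩ := exists_hasDerivAt_eq_slope (fun s => f (x s))
      (fun t => -‖gradient f (x t)‖ ^ 2) (lt_add_one (k : ℝ))
      (fun s hs => ((hder s (hk.trans hs.1)).continuousWithinAt).mono fun u hu => hk.trans hu.1)
      (fun s hs => (hder s (hk.trans hs.1.le)).hasDerivAt (Ici_mem_nhds (hk.trans_lt hs.1)))
    refine ⟨t, hk.trans ht.1.le, ?_⟩
    simp only [add_sub_cancel_left, div_one] at h
    push_cast
    linarith
  choose t ht0 ht using hmvt
  have hval : Antitone fun k : ℕ => f (x k) := fun i j hij =>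
    hanti (mem_Ici.2 i.cast_nonneg) (mem_Ici.2 j.cast_nonneg) (Nat.cast_le.2 hij)
  have hlim := tendsto_atTop_ciInf hval (hbdd.mono (by rintro _ ⟨k, rfl⟩; exact ⟨_, rfl⟩))
  have hgrad : Tendsto (fun k => ‖gradient f (x (t k))‖ ^ 2) atTop (𝓝 0) := by
    simp only [ht]
    simpa using hlim.sub (hlim.comp (tendsto_add_atTop_nat 1))
  obtain ⟨p, -, φ, hφ, hp⟩ := (isCompact_closedBall (0 : E) r).tendsto_subseq
    (x := fun k => x (t k)) (fun k => by simpa using hr _ (ht0 k))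
  have hcont : Continuous (gradient f) :=
    (InnerProductSpace.toDual ℝ E).symm.continuous.comp (hf.continuous_fderiv one_ne_zero)
  refine ⟨p, hS.mem_of_tendsto hp (Eventually.of_forall fun k => hmem _ (ht0 _)), ?_, ?_⟩
  · have h := tendsto_nhds_unique (((hcont.norm.pow 2).tendsto p).comp hp)
      (hgrad.comp hφ.tendsto_atTop)
    simpa using h
  · exact le_of_tendsto ((hf.continuous.tendsto p).comp hp)
      (Eventually.of_forall fun k => hanti self_mem_Ici (ht0 _) (ht0 _))

end GradientCurves

/-- A minimizer of `f` over a setwise local minimum is a local minimum. -/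
theorem SetwiseLocalMin.isLocalMin {E : Type*} [TopologicalSpace E] {f : E → ℝ} {S : Set E}
    (hS : SetwiseLocalMin f S) {p : E} (hp : p ∈ S) (hmin : ∀ y ∈ S, f p ≤ f y) :
    IsLocalMin f p := by
  obtain ⟨-, -, U, hU, hSU, h⟩ := hS
  filter_upwards [hU.mem_nhds (hSU hp)] with y hy
  by_cases hyS : y ∈ S
  · exact hmin y hyS
  · exact h p hp y ⟨hy, hyS⟩

theorem IsLocalMin.setwiseLocalMin_singleton {E : Type*} [TopologicalSpace E] [T1Space E]
    {f : E → ℝ} {p : E} (hp : IsLocalMin f p) : SetwiseLocalMin f {p} := by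
  obtain ⟨U, hU, hUo, hpU⟩ := eventually_nhds_iff.1 hp
  refine ⟨singleton_nonempty p, isClosed_singleton, U, hUo, singleton_subset_iff.2 hpU, ?_⟩
  rintro _ rfl y hy
  exact hU y hy.1

theorem stmt0 {n : ℕ} (f : EuclideanSpace ℝ (Fin n) → ℝ)
    (hC1 : ContDiff ℝ 1 f)
    (hbdd : BddBelow (Set.range f))
    (hcrit : (f '' {x | gradient f x = 0}).Finite)
    (htraj : ∀ x₀ : EuclideanSpace ℝ (Fin n),
      ∃ (x : ℝ → EuclideanSpace ℝ (Fin n)) (r : ℝ), 0 < r ∧ x 0 = x₀ ∧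
        (∀ t ≥ (0:ℝ), HasDerivWithinAt x (-gradient f (x t)) (Set.Ici 0) t) ∧
        ∀ t ≥ (0:ℝ), ‖x t‖ ≤ r) :
    (∀ p, IsLocalMin f p → ∀ y, f p ≤ f y) ↔
      (∀ S, SetwiseLocalMin f S → sInf (f '' S) = sInf (Set.range f)) := by
  constructor
  · intro hloc S hS
    have hcritS : ∀ y ∈ S, ∃ p ∈ S, gradient f p = 0 ∧ f p ≤ f y := by
      intro y hy
      obtain ⟨x, r, -, rfl, hx, hr⟩ := htraj y
      exact exists_critical_le_of_bounded_gradient_curve hC1 hbdd hx hr hS.2.1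
        fun t ht => hS.gradient_curve_mem (hC1.differentiable one_ne_zero) hx hy ht
    have hfin : (f '' {p | p ∈ S ∧ gradient f p = 0}).Finite :=
      hcrit.subset (image_mono fun p hp => hp.2)
    obtain ⟨y₀, hy₀⟩ := hS.1
    obtain ⟨p₀, hp₀S, hp₀, -⟩ := hcritS y₀ hy₀
    obtain ⟨_, ⟨p, ⟨hpS, -⟩, rfl⟩, hpmin⟩ :=
      hfin.exists_minimal ⟨_, mem_image_of_mem f ⟨hp₀S, hp₀⟩⟩
    have hminS : ∀ y ∈ S, f p ≤ f y := fun y hy => by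
      obtain ⟨q, hqS, hq, hqy⟩ := hcritS y hy
      exact ((le_total (f p) (f q)).elim id
        (hpmin (mem_image_of_mem f ⟨hqS, hq⟩))).trans hqy
    have hglob := hloc p (hS.isLocalMin hpS hminS)
    have h1 : IsLeast (f '' S) (f p) := ⟨mem_image_of_mem f hpS, forall_mem_image.2 hminS⟩
    have h2 : IsLeast (range f) (f p) := ⟨mem_range_self p, forall_mem_range.2 hglob⟩
    rw [h1.csInf_eq, h2.csInf_eq]
  · intro hset p hp y
    have h := hset {p} hp.setwiseLocalMin_singleton
    rw [image_singleton, csInf_singleton] at h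
    exact h ▸ csInf_le hbdd (mem_range_self y)
end

section
/- If S is a setwise local minimum of a continuous function f : ℝ^n → ℝ, then f(x) = sup_{z∈S} f(z) for every x in the boundary ∂S = S \ S° of S (S° denoting the interior of S; S is closed so its boundary is contained in S). -/
open Set

/-- A continuous function attains its maximum over a setwise local minimum `S` at every
boundary point of `S`. -/
theorem SetwiseLocalMin.isGreatest_image {E : Type*} [TopologicalSpace E] {f : E → ℝ}
    (hf : Continuous f) {S : Set E} (hS : SetwiseLocalMin f S) {x : E}
    (hx : x ∈ S \ interior S) : IsGreatest (f '' S) (f x) := by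
  obtain ⟨-, -, U, hU, hSU, hmin⟩ := hS
  refine ⟨mem_image_of_mem f hx.1, ?_⟩
  rintro _ ⟨z, hz, rfl⟩
  by_contra! hlt
  have hcl : x ∈ closure Sᶜ := by
    rw [closure_compl]
    exact hx.2
  obtain ⟨y, ⟨hyU, hyz⟩, hyS⟩ := mem_closure_iff.1 hcl (U ∩ {y | f y < f z})
    (hU.inter (isOpen_lt hf continuous_const)) ⟨hSU hx.1, hlt⟩
  exact (hmin z hz y ⟨hyU, hyS⟩).not_gt hyz

theorem stmt1 {n : ℕ} (f : EuclideanSpace ℝ (Fin n) → ℝ) (hf : Continuous f)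
    (S : Set (EuclideanSpace ℝ (Fin n))) (hS : SetwiseLocalMin f S)
    (x : EuclideanSpace ℝ (Fin n)) (hx : x ∈ S \ interior S) :
    f x = sSup (f '' S) := by
  exact (hS.isGreatest_image hf hx).csSup_eq.symm
end

section
/- Let f : ℝ^n → ℝ be continuous and a ∈ ℝ be such that the sublevel set {x ∈ ℝ^n : f(x) ≤ a} is nonempty and has finitely many connected components. Then every connected component of {x ∈ ℝ^n : f(x) ≤ a} is a strict setwise local minimum of f. -/
open Set

/-- A nonempty closed set `S` is a *strict setwise local minimum* of `f`. -/
def StrictSetwiseLocalMin {E : Type*} [TopologicalSpace E] (f : E → ℝ) (S : Set E) : Prop :=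
  S.Nonempty ∧ IsClosed S ∧ ∃ U : Set E, IsOpen U ∧ S ⊆ U ∧ ∀ x ∈ S, ∀ y ∈ U \ S, f x < f y

/-- If a nonempty sublevel set of a continuous `f : ℝⁿ → ℝ` has finitely many connected
components, then each of its connected components is a strict setwise local minimum of `f`. -/
theorem stmt4 {n : ℕ} (f : EuclideanSpace ℝ (Fin n) → ℝ) (hf : Continuous f) (a : ℝ)
    (hne : {x | f x ≤ a}.Nonempty)
    (hfin : {C | ∃ x ∈ {x | f x ≤ a}, C = connectedComponentIn {x | f x ≤ a} x}.Finite) :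
    ∀ x, f x ≤ a → StrictSetwiseLocalMin f (connectedComponentIn {x | f x ≤ a} x) := by
  intro x hx
  have hcl : ∀ z, f z ≤ a → IsClosed (connectedComponentIn {x | f x ≤ a} z) := by
    intro z hz
    have hs : IsClosed {x | f x ≤ a} := isClosed_le hf continuous_const
    refine closure_subset_iff_isClosed.mp ?_
    exact isPreconnected_connectedComponentIn.closure.subset_connectedComponentIn
      (subset_closure (mem_connectedComponentIn hz))
      (closure_minimal (connectedComponentIn_subset _ _) hs)
  set C := connectedComponentIn {x | f x ≤ a} x
  set T := {D | ∃ z ∈ {x | f x ≤ a}, D = connectedComponentIn {x | f x ≤ a} z} \ {C}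
  refine ⟨⟨x, mem_connectedComponentIn hx⟩, hcl x hx, (⋃₀ T)ᶜ, ?_, ?_, ?_⟩
  · rw [isOpen_compl_iff, sUnion_eq_biUnion]
    refine (hfin.subset sdiff_subset).isClosed_biUnion ?_
    rintro D ⟨⟨z, hz, rfl⟩, -⟩
    exact hcl z hz
  · rintro y hy ⟨D, ⟨⟨z, hz, rfl⟩, hne'⟩, hyD⟩
    exact hne' ((connectedComponentIn_eq hyD).trans (connectedComponentIn_eq hy).symm)
  · rintro u hu y ⟨hyU, hyC⟩
    have hua : u ∈ {x | f x ≤ a} := connectedComponentIn_subset _ _ hu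
    refine lt_of_le_of_lt hua ?_
    by_contra! hya
    have hy := mem_connectedComponentIn (F := {x | f x ≤ a}) hya
    exact hyU ⟨_, ⟨⟨y, hya, rfl⟩, fun h => hyC (h ▸ hy)⟩, hy⟩
end

section
/- If f : ℝ^n → ℝ is continuous and coercive (that is, f(x) → ∞ as ‖x‖ → ∞), then every unbounded setwise local minimum S of f is a setwise global minimum, i.e. inf_{x∈S} f(x) = inf_{x∈ℝ^n} f(x); equivalently, f has no spurious local minima at infinity. -/
open Set

/-- A continuous coercive function `f : ℝⁿ → ℝ` has no spurious local minima at infinity: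
every unbounded setwise local minimum is a setwise global minimum. -/
theorem stmt5 {n : ℕ} (f : EuclideanSpace ℝ (Fin n) → ℝ) (hf : Continuous f)
    (hcoercive : ∀ M : ℝ, ∃ R : ℝ, ∀ x : EuclideanSpace ℝ (Fin n), R ≤ ‖x‖ → M ≤ f x)
    (S : Set (EuclideanSpace ℝ (Fin n))) (hS : SetwiseLocalMin f S)
    (hunbdd : ¬ Bornology.IsBounded S) :
    sInf (f '' S) = sInf (Set.range f) := by
  obtain ⟨hne, hclosed, U, hUo, hSU, hmin⟩ := hS
  have hUS : U ⊆ S := by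
    intro y hyU
    by_contra hyS
    obtain ⟨R, hR⟩ := hcoercive (f y + 1)
    refine hunbdd (isBounded_iff_forall_norm_le.2 ⟨R, fun x hx => ?_⟩)
    by_contra! hlt
    linarith [hR x hlt.le, hmin x hx y ⟨hyU, hyS⟩]
  have hopen : IsOpen S := hSU.antisymm hUS ▸ hUo
  rw [IsClopen.eq_univ ⟨hclosed, hopen⟩ hne, image_univ]
end

section
/- If f : ℝ^n → ℝ is continuously differentiable and bounded below (inf_{ℝ^n} f > −∞), then for every x₀ ∈ ℝ^n there exists a gradient trajectory of f starting at x₀ defined on all of [0,∞), i.e. a differentiable curve x : [0,∞) → ℝ^n with x(0) = x₀ and x'(t) = −∇f(x(t)) for all t ≥ 0. -/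
open Set

section MinimizingMovement

open Filter Topology

variable {E : Type*} [NormedAddCommGroup E]

/-- One implicit Euler step: a minimizer of `y ↦ f y + ‖y - x‖² / (2h)`. -/
theorem exists_implicit_gradient_step [InnerProductSpace ℝ E] [ProperSpace E] {f : E → ℝ}
    (hf : ContDiff ℝ 1 f) (hbdd : BddBelow (range f)) {h : ℝ} (hh : 0 < h) (x : E) :
    ∃ y : E, y - x = -(h • gradient f y) ∧ ‖y - x‖ ^ 2 ≤ 2 * h * (f x - f y) := by
  obtain ⟨c, hc⟩ := hbdd
  have hcont : Continuous fun y => f y + (2 * h)⁻¹ * ‖y - x‖ ^ 2 := by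
    have := hf.continuous
    fun_prop
  have hnorm : Tendsto (fun y : E => ‖y - x‖) (cocompact E) atTop := by
    simpa only [dist_eq_norm] using tendsto_dist_right_cocompact_atTop x
  have hlim : Tendsto (fun y => f y + (2 * h)⁻¹ * ‖y - x‖ ^ 2) (cocompact E) atTop := by
    refine tendsto_atTop_add_left_of_le _ c (fun y => hc (mem_range_self y)) ?_
    exact (tendsto_pow_atTop two_ne_zero |>.comp hnorm).const_mul_atTop (by positivity)
  obtain ⟨y, hy⟩ := hcont.exists_forall_le hlim
  refine ⟨y, ?_, ?_⟩
  · have hd := (hf.differentiable one_ne_zero y).hasGradientAt.hasFDerivAt.add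
      ((((hasFDerivAt_id y).sub_const x).norm_sq).const_mul (2 * h)⁻¹)
    have h0 := IsLocalMin.hasFDerivAt_eq_zero (Eventually.of_forall hy) hd
    refine ext_inner_right ℝ fun w => ?_
    have hw := DFunLike.congr_fun h0 w
    simp at hw
    have hgrad : inner ℝ (gradient f y) w = fderiv ℝ f y w := by simp [gradient]
    rw [inner_neg_left, real_inner_smul_left, hgrad, inner_sub_left]
    field_simp at hw
    linarith
  · have hx := hy x
    simp only [sub_self, norm_zero] at hx
    field_simp at hx
    linarith

/-- The properties of a sequence of implicit Euler steps of length `h` started at `x₀`. -/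
theorem exists_implicit_gradient_sequence [InnerProductSpace ℝ E] [ProperSpace E] {f : E → ℝ}
    (hf : ContDiff ℝ 1 f) (hbdd : BddBelow (range f)) {h : ℝ} (hh : 0 < h) (x₀ : E) :
    ∃ u : ℕ → E, u 0 = x₀ ∧ (∀ k, u (k + 1) - u k = -(h • gradient f (u (k + 1)))) ∧
      ∀ k, ‖u (k + 1) - u k‖ ^ 2 ≤ 2 * h * (f (u k) - f (u (k + 1))) := by
  choose F hF₁ hF₂ using exists_implicit_gradient_step hf hbdd hh
  exact ⟨fun k => k.rec x₀ fun _ => F, rfl, fun k => hF₁ _, fun k => hF₂ _⟩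

/-- Discrete Hölder estimate for a sequence satisfying the energy inequality. -/
theorem norm_sub_sq_le_of_energy {f : E → ℝ} {c h : ℝ} (hc : ∀ y, c ≤ f y) (hh : 0 < h)
    {u : ℕ → E} (hu : ∀ k, ‖u (k + 1) - u k‖ ^ 2 ≤ 2 * h * (f (u k) - f (u (k + 1))))
    {i j : ℕ} (hij : i ≤ j) :
    ‖u j - u i‖ ^ 2 ≤ 2 * (f (u 0) - c) * ((j - i : ℝ) * h) := by
  have hanti : Antitone fun k => f (u k) := antitone_nat_of_succ_le fun k => by
    have : 0 ≤ 2 * h * (f (u k) - f (u (k + 1))) := (sq_nonneg _).trans (hu k)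
    have := nonneg_of_mul_nonneg_right this (by positivity)
    linarith
  have hsum : ∑ k ∈ Finset.Ico i j, ‖u (k + 1) - u k‖ ^ 2 ≤ 2 * h * (f (u i) - f (u j)) := by
    refine (Finset.sum_le_sum fun k _ => hu k).trans_eq ?_
    rw [← Finset.mul_sum, ← neg_sub (f (u j)), ← Finset.sum_Ico_sub (fun k => f (u k)) hij,
      ← Finset.sum_neg_distrib]
    simp
  have hcard : ((Finset.Ico i j).card : ℝ) = j - i := by simp [Nat.cast_sub hij]
  have hji : (0 : ℝ) ≤ j - i := sub_nonneg.2 (by exact_mod_cast hij)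
  calc ‖u j - u i‖ ^ 2 = ‖∑ k ∈ Finset.Ico i j, (u (k + 1) - u k)‖ ^ 2 := by
        rw [Finset.sum_Ico_sub _ hij]
    _ ≤ (∑ k ∈ Finset.Ico i j, ‖u (k + 1) - u k‖) ^ 2 := by
        gcongr
        exact norm_sum_le _ _
    _ ≤ (j - i : ℝ) * ∑ k ∈ Finset.Ico i j, ‖u (k + 1) - u k‖ ^ 2 := by
        rw [← hcard]
        exact sq_sum_le_card_mul_sum_sq
    _ ≤ (j - i : ℝ) * (2 * h * (f (u 0) - c)) := by
        gcongr
        refine hsum.trans ?_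
        gcongr
        exacts [hanti (Nat.zero_le i), hc _]
    _ = _ := by ring

/-- If the slopes of an implicit Euler sequence are `ε`-close to `v`, so is the mean slope. -/
theorem norm_sub_add_smul_le_of_step [NormedSpace ℝ E] {g : E → E} {h ε : ℝ} (hh : 0 < h)
    {u : ℕ → E} (hu : ∀ k, u (k + 1) - u k = -(h • g (u (k + 1)))) {i j : ℕ} (hij : i ≤ j) {v : E}
    (hv : ∀ k ∈ Finset.Ico i j, ‖g (u (k + 1)) - v‖ ≤ ε) :
    ‖u j - u i + ((j - i : ℝ) * h) • v‖ ≤ ε * ((j - i : ℝ) * h) := by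
  have hcard : ((Finset.Ico i j).card : ℝ) = j - i := by simp [Nat.cast_sub hij]
  have hsum : u j - u i + ((j - i : ℝ) * h) • v =
      ∑ k ∈ Finset.Ico i j, (-h) • (g (u (k + 1)) - v) := by
    rw [← Finset.sum_Ico_sub _ hij, ← hcard, mul_smul, Nat.cast_smul_eq_nsmul,
      ← Finset.sum_const, ← Finset.sum_add_distrib]
    refine Finset.sum_congr rfl fun k _ => ?_
    rw [hu k]
    module
  rw [hsum]
  refine (norm_sum_le_of_le _ (n := fun _ => h * ε) fun k hk => ?_).trans_eq ?_
  · rw [norm_smul, norm_neg, Real.norm_of_nonneg hh.le]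
    gcongr
    exact hv k hk
  · rw [Finset.sum_const, nsmul_eq_mul, hcard]
    ring

/-- A curve whose difference quotients are locally uniformly close to `g ∘ x` is an integral
curve of `g`. -/
theorem hasDerivWithinAt_Ici_of_uniform_slope [NormedSpace ℝ E] {x : ℝ → E} {g : E → E}
    (hx : ∀ T : ℝ, ∀ ε > 0, ∃ δ > 0, ∀ s r t : ℝ, 0 ≤ s → s ≤ r → r ≤ t → t ≤ T → t - s < δ →
      ‖x t - x s + (t - s) • g (x r)‖ ≤ ε * (t - s)) {t : ℝ} (ht : 0 ≤ t) :
    HasDerivWithinAt x (-g (x t)) (Ici 0) t := by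
  rw [hasDerivWithinAt_iff_isLittleO, Asymptotics.isLittleO_iff]
  intro ε hε
  obtain ⟨δ, hδ, H⟩ := hx (t + 1) ε hε
  filter_upwards [self_mem_nhdsWithin,
    mem_nhdsWithin_of_mem_nhds (Metric.ball_mem_nhds t (lt_min hδ one_pos))] with s hs hst
  rw [Metric.mem_ball, Real.dist_eq, lt_min_iff, abs_lt, abs_lt] at hst
  rw [smul_neg, sub_neg_eq_add, Real.norm_eq_abs]
  rcases le_total t s with hts | hts
  · rw [abs_of_nonneg (sub_nonneg.2 hts)]
    exact H t t s ht le_rfl hts (by linarith) (by linarith)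
  · rw [abs_of_nonpos (sub_nonpos.2 hts), neg_sub, ← norm_neg]
    have key := H s t t hs hts le_rfl (by linarith) (by linarith)
    rwa [show -(x s - x t + (s - t) • g (x t)) = x t - x s + (t - s) • g (x t) by module]

/-- Global existence of gradient trajectories in a proper inner product space. -/
theorem exists_gradient_trajectory [InnerProductSpace ℝ E] [ProperSpace E] {f : E → ℝ}
    (hf : ContDiff ℝ 1 f) (hbdd : BddBelow (range f)) (x₀ : E) :
    ∃ x : ℝ → E, x 0 = x₀ ∧
      ∀ t ≥ (0 : ℝ), HasDerivWithinAt x (-gradient f (x t)) (Ici 0) t := by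
  have hstep (N : ℕ) : (0 : ℝ) < ((N : ℝ) + 1)⁻¹ := by positivity
  choose u hu₀ hu₁ hu₂ using fun N : ℕ =>
    exists_implicit_gradient_sequence hf hbdd (hstep N) x₀
  obtain ⟨c, hc⟩ := hbdd
  replace hc : ∀ y, c ≤ f y := fun y => hc (mem_range_self y)
  have hg : Continuous (gradient f) :=
    (InnerProductSpace.toDual ℝ E).symm.continuous.comp (hf.continuous_fderiv one_ne_zero)
  set C := 2 * (f x₀ - c) with hC
  have hC0 : 0 ≤ C := by linarith [hc x₀]
  have hold (N : ℕ) {i j : ℕ} (hij : i ≤ j) :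
      ‖u N j - u N i‖ ^ 2 ≤ C * ((j - i : ℝ) * ((N : ℝ) + 1)⁻¹) := by
    simpa only [hu₀] using norm_sub_sq_le_of_energy hc (hstep N) (hu₂ N) hij
  let a (t : ℝ) (N : ℕ) : ℕ := ⌊t * ((N : ℝ) + 1)⌋₊
  have ha_mono (N : ℕ) {s t : ℝ} (hst : s ≤ t) : a s N ≤ a t N :=
    Nat.floor_mono (by gcongr)
  have ha_le (N : ℕ) {t : ℝ} (ht : 0 ≤ t) : (a t N : ℝ) * ((N : ℝ) + 1)⁻¹ ≤ t := by
    rw [← div_eq_mul_inv, div_le_iff₀ (by positivity)]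
    exact Nat.floor_le (by positivity)
  have hball {T : ℝ} (hT : 0 ≤ T) (N : ℕ) {k : ℕ} (hk : k ≤ a T N) :
      u N k ∈ Metric.closedBall x₀ (√(C * T)) := by
    rw [mem_closedBall_iff_norm]
    apply Real.le_sqrt_of_sq_le
    rw [← hu₀ N]
    refine (hold N (Nat.zero_le k)).trans ?_
    gcongr
    refine le_trans ?_ (ha_le N hT)
    rw [Nat.cast_zero, sub_zero]
    gcongr
  let U : Ultrafilter ℕ := hyperfilter ℕ
  have hU : (U : Filter ℕ) ≤ atTop := Nat.hyperfilter_le_atTop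
  have hlim (t : ℝ) : ∃ y, 0 ≤ t → Tendsto (fun N => u N (a t N)) U (𝓝 y) := by
    by_cases ht : 0 ≤ t
    · obtain ⟨y, -, hy⟩ := (isCompact_closedBall x₀ (√(C * t))).ultrafilter_le_nhds'
        (U.map fun N => u N (a t N))
        (Ultrafilter.mem_map.2 (univ_mem' fun N => hball ht N le_rfl))
      exact ⟨y, fun _ => hy⟩
    · exact ⟨x₀, fun h => absurd h ht⟩
  choose x hx using hlim
  refine ⟨x, ?_, fun t ht => hasDerivWithinAt_Ici_of_uniform_slope (fun T ε hε => ?_) ht⟩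
  · refine tendsto_nhds_unique (hx 0 le_rfl) ?_
    simp [a, hu₀]
  obtain ⟨ρ, hρ, hgρ⟩ := Metric.uniformContinuousOn_iff.1
    ((isCompact_closedBall x₀ (√(C * T))).uniformContinuousOn_of_continuous hg.continuousOn) ε hε
  refine ⟨ρ ^ 2 / (C + 1), by positivity, fun s r t hs hsr hrt htT hts => ?_⟩
  have hr := hs.trans hsr
  have ht := hr.trans hrt
  have hT := ht.trans htT
  have hfloor {t : ℝ} (ht : 0 ≤ t) :
      Tendsto (fun N => (a t N : ℝ) * ((N : ℝ) + 1)⁻¹) U (𝓝 t) :=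
    ((tendsto_nat_floor_mul_div_atTop ht).comp
      (tendsto_atTop_add_const_right _ 1 tendsto_natCast_atTop_atTop)).mono_left hU
  have hdiff : Tendsto (fun N => ((a t N : ℝ) - a s N) * ((N : ℝ) + 1)⁻¹) U (𝓝 (t - s)) := by
    simpa only [sub_mul] using (hfloor ht).sub (hfloor hs)
  have hsmall : C * (t - s) < ρ ^ 2 := by
    rw [lt_div_iff₀ (by positivity)] at hts
    nlinarith
  refine le_of_tendsto_of_tendsto (((hx t ht).sub (hx s hs)).add
    (hdiff.smul ((hg.tendsto _).comp (hx r hr)))).norm (hdiff.const_mul ε) ?_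
  filter_upwards [(hdiff.const_mul C).eventually_lt_const hsmall] with N hN
  have hir := ha_mono N hsr
  have hrj := ha_mono N hrt
  have hjT := ha_mono N htT
  have hclose {p q : ℕ} (hp : a s N ≤ p) (hpq : p ≤ q) (hq : q ≤ a t N) :
      ‖u N q - u N p‖ < ρ := by
    refine lt_of_pow_lt_pow_left₀ 2 hρ.le (((hold N hpq).trans ?_).trans_lt hN)
    gcongr
  refine norm_sub_add_smul_le_of_step (hstep N) (hu₁ N) (hir.trans hrj) fun k hk => ?_
  rw [Finset.mem_Ico] at hk
  rw [← dist_eq_norm]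
  refine (hgρ _ (hball hT N (by omega)) _ (hball hT N (hrj.trans hjT)) ?_).le
  rcases le_total (a r N) (k + 1) with h | h
  · rw [dist_eq_norm]
    exact hclose hir h (by omega)
  · rw [dist_comm, dist_eq_norm]
    exact hclose (by omega) h hrj

end MinimizingMovement

/-- A continuously differentiable function `f : ℝⁿ → ℝ` that is bounded below admits a
gradient trajectory starting at any point, defined on all of `[0,∞)`. -/
theorem stmt6 {n : ℕ} (f : EuclideanSpace ℝ (Fin n) → ℝ)
    (hC1 : ContDiff ℝ 1 f) (hbdd : BddBelow (Set.range f))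
    (x₀ : EuclideanSpace ℝ (Fin n)) :
    ∃ x : ℝ → EuclideanSpace ℝ (Fin n), x 0 = x₀ ∧
      ∀ t ≥ (0:ℝ), HasDerivWithinAt x (-gradient f (x t)) (Set.Ici 0) t :=
  exists_gradient_trajectory hC1 hbdd x₀
end

section
/- Let L ≥ 2, x, y ∈ ℝ, let σ(z) := (1 + e^{−z})^{−1} be the sigmoid function, and define f(w₁,…,w_L) := (1/2)(w_L σ(w_{L−1} σ(⋯ σ(w₁ x) ⋯)) − y)² for (w₁,…,w_L) ∈ ℝ^L. Then every gradient trajectory of f is bounded: if w : [0,∞) → ℝ^L is differentiable with w'(t) = −∇f(w(t)) for all t ≥ 0, then there exists r > 0 such that ‖w(t)‖ ≤ r for all t ≥ 0. -/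
open Set

/-- The sigmoid activation function. -/
noncomputable def sigmoid (z : ℝ) : ℝ := (1 + Real.exp (-z))⁻¹

/-- Hidden activations of a one-dimensional deep sigmoid network with input `x`:
`sigHidden L x w 0 = x` and `sigHidden L x w (k+1) = σ(w_{k+1} ⬝ sigHidden L x w k)`
(weights are 0-indexed). -/
noncomputable def sigHidden (L : ℕ) (x : ℝ) (w : EuclideanSpace ℝ (Fin L)) : ℕ → ℝ
  | 0 => x
  | (k + 1) => sigmoid ((if h : k < L then w ⟨k, h⟩ else 0) * sigHidden L x w k)

theorem sigmoid_pos (z : ℝ) : 0 < sigmoid z := Real.sigmoid_pos z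

theorem sigmoid_lt_one (z : ℝ) : sigmoid z < 1 := Real.sigmoid_lt_one z

theorem sigmoid_le_sigmoid {a b : ℝ} (h : a ≤ b) : sigmoid a ≤ sigmoid b :=
  Real.sigmoid_monotone h

theorem hasDerivAt_sigmoid (z : ℝ) :
    HasDerivAt sigmoid (sigmoid z * (1 - sigmoid z)) z :=
  Real.hasDerivAt_sigmoid z

/-- The `k`-th weight as a continuous linear functional, zero for `k ≥ L`. -/
noncomputable def weight (L k : ℕ) : EuclideanSpace ℝ (Fin L) →L[ℝ] ℝ :=
  if h : k < L then EuclideanSpace.proj ⟨k, h⟩ else 0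

/-- The pre-activation of layer `k`. -/
noncomputable def preact (L : ℕ) (x : ℝ) (k : ℕ) (w : EuclideanSpace ℝ (Fin L)) : ℝ :=
  weight L k w * sigHidden L x w k

theorem weight_apply {L k : ℕ} (h : k < L) (w : EuclideanSpace ℝ (Fin L)) :
    weight L k w = w ⟨k, h⟩ := by
  simp [weight, h]

theorem weight_single (L k : ℕ) (i : Fin L) (c : ℝ) :
    weight L k (EuclideanSpace.single i c) = if k = i then c else 0 := by
  by_cases h : k < L
  · simp [weight_apply h, Fin.ext_iff]
  · have : k ≠ i := by omega
    simp [weight, h, this]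

theorem sigHidden_succ (L : ℕ) (x : ℝ) (w : EuclideanSpace ℝ (Fin L)) (k : ℕ) :
    sigHidden L x w (k + 1) = sigmoid (preact L x k w) := by
  by_cases h : k < L <;> simp [sigHidden, preact, weight, h]

theorem differentiable_sigHidden (L : ℕ) (x : ℝ) (k : ℕ) :
    Differentiable ℝ fun w => sigHidden L x w k := by
  induction k with
  | zero => exact differentiable_const x
  | succ k ih =>
    simp only [sigHidden_succ]
    have hs : Differentiable ℝ sigmoid := fun z => (hasDerivAt_sigmoid z).differentiableAt
    exact hs.comp ((weight L k).differentiable.mul ih)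

theorem differentiable_preact (L : ℕ) (x : ℝ) (k : ℕ) : Differentiable ℝ (preact L x k) :=
  (weight L k).differentiable.mul (differentiable_sigHidden L x k)

theorem fderiv_preact (L : ℕ) (x : ℝ) (k : ℕ) (w h : EuclideanSpace ℝ (Fin L)) :
    fderiv ℝ (preact L x k) w h = weight L k h * sigHidden L x w k +
      weight L k w * fderiv ℝ (fun v => sigHidden L x v k) w h := by
  have := (weight L k).hasFDerivAt.mul (differentiable_sigHidden L x k w).hasFDerivAt
  rw [show preact L x k = ⇑(weight L k) * fun v => sigHidden L x v k from rfl, this.fderiv]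
  simp
  ring

theorem fderiv_sigHidden_succ (L : ℕ) (x : ℝ) (k : ℕ) (w h : EuclideanSpace ℝ (Fin L)) :
    fderiv ℝ (fun v => sigHidden L x v (k + 1)) w h =
      sigHidden L x w (k + 1) * (1 - sigHidden L x w (k + 1)) *
        fderiv ℝ (preact L x k) w h := by
  simp only [sigHidden_succ]
  have := (hasDerivAt_sigmoid (preact L x k w)).comp_hasFDerivAt w
    (differentiable_preact L x k w).hasFDerivAt
  rw [show (fun v => sigmoid (preact L x k v)) = sigmoid ∘ preact L x k from rfl, this.fderiv]
  simp

theorem fderiv_sigHidden_eq_zero (L : ℕ) (x : ℝ) (k : ℕ) (w h : EuclideanSpace ℝ (Fin L))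
    (hh : ∀ j < k, weight L j h = 0) :
    fderiv ℝ (fun v => sigHidden L x v k) w h = 0 := by
  induction k with
  | zero => simp [sigHidden]
  | succ k ih =>
    rw [fderiv_sigHidden_succ, fderiv_preact, hh k (by omega),
      ih fun j hj => hh j (by omega)]
    simp

/-- Moving the weights `i` and `i + 1` at suitable relative speeds leaves all later
pre-activations stationary. -/
theorem fderiv_preact_eq_zero (L : ℕ) (x : ℝ) (i m : ℕ) (w h : EuclideanSpace ℝ (Fin L))
    (hm : i + 1 ≤ m) (hh : ∀ j, j ≠ i → j ≠ i + 1 → weight L j h = 0)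
    (hi : weight L (i + 1) h = -((1 - sigHidden L x w (i + 1)) * sigHidden L x w i *
      weight L (i + 1) w * weight L i h)) :
    fderiv ℝ (preact L x m) w h = 0 := by
  induction m, hm using Nat.le_induction with
  | base =>
    rw [fderiv_preact, fderiv_sigHidden_succ, fderiv_preact,
      fderiv_sigHidden_eq_zero L x i w h fun j hj => hh j (by omega) (by omega), hi]
    ring
  | succ m hm ih =>
    rw [fderiv_preact, fderiv_sigHidden_succ, ih, hh (m + 1) (by omega) (by omega)]
    simp

theorem fderiv_preact_single (L : ℕ) (x : ℝ) (i m : ℕ) (hi : i + 1 < L) (hm : i + 1 ≤ m)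
    (w : EuclideanSpace ℝ (Fin L)) :
    fderiv ℝ (preact L x m) w (EuclideanSpace.single ⟨i, by omega⟩ 1) =
      (1 - sigHidden L x w (i + 1)) * sigHidden L x w i * weight L (i + 1) w *
        fderiv ℝ (preact L x m) w (EuclideanSpace.single ⟨i + 1, hi⟩ 1) := by
  set c := (1 - sigHidden L x w (i + 1)) * sigHidden L x w i * weight L (i + 1) w with hc
  have := fderiv_preact_eq_zero L x i m w (EuclideanSpace.single ⟨i, by omega⟩ 1 -
    c • EuclideanSpace.single ⟨i + 1, hi⟩ 1) hm
    (fun j h1 h2 => by simp [weight_single, h1, h2])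
    (by simp [weight_single, hc])
  rw [map_sub, map_smul, smul_eq_mul] at this
  linarith

theorem fderiv_preact_single_self (L : ℕ) (x : ℝ) (m : ℕ) (hm : m < L)
    (w : EuclideanSpace ℝ (Fin L)) :
    fderiv ℝ (preact L x m) w (EuclideanSpace.single ⟨m, hm⟩ 1) = sigHidden L x w m := by
  rw [fderiv_preact, fderiv_sigHidden_eq_zero L x m w _ fun j hj => by
    simp [weight_single, hj.ne]]
  simp [weight_single]

theorem monotoneOn_of_hasDerivWithinAt_Ici {a : ℝ} {u u' : ℝ → ℝ}
    (hu : ∀ t ≥ a, HasDerivWithinAt u (u' t) (Ici a) t) (h : ∀ t ≥ a, 0 ≤ u' t) :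
    MonotoneOn u (Ici a) := by
  refine monotoneOn_of_hasDerivWithinAt_nonneg (f' := u') (convex_Ici a)
    (fun t ht => (hu t ht).continuousWithinAt) (fun t ht => ?_) fun t ht => ?_
  · exact (hu t (interior_subset ht)).mono interior_subset
  · exact h t (interior_subset ht)

theorem abs_sub_le_of_abs_deriv_le {a C : ℝ} {v v' u u' : ℝ → ℝ}
    (hv : ∀ t ≥ a, HasDerivWithinAt v (v' t) (Ici a) t)
    (hu : ∀ t ≥ a, HasDerivWithinAt u (u' t) (Ici a) t)
    (h : ∀ t ≥ a, |v' t| ≤ C * u' t) {t : ℝ} (ht : a ≤ t) :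
    |v t - v a| ≤ C * (u t - u a) := by
  have h1 := monotoneOn_of_hasDerivWithinAt_Ici
    (fun s hs => ((hu s hs).const_mul C).sub (hv s hs))
    (fun s hs => by linarith [(abs_le.1 (h s hs)).2]) self_mem_Ici ht ht
  have h2 := monotoneOn_of_hasDerivWithinAt_Ici
    (fun s hs => ((hu s hs).const_mul C).add (hv s hs))
    (fun s hs => by linarith [(abs_le.1 (h s hs)).1]) self_mem_Ici ht ht
  simp only [Pi.sub_apply, Pi.add_apply] at h1 h2
  rw [abs_le]
  constructor <;> linarith

/-- A continuous function whose absolute value is nonincreasing does not change sign. -/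
theorem exists_sign_of_antitoneOn_abs {e : ℝ → ℝ} (hc : ContinuousOn e (Ici 0))
    (ha : AntitoneOn (fun t => |e t|) (Ici 0)) :
    ∃ s : ℝ, s ^ 2 = 1 ∧ ∀ t ≥ (0 : ℝ), 0 ≤ s * e t := by
  by_contra! hcon
  obtain ⟨p, hp, hep⟩ := hcon 1 (by norm_num)
  obtain ⟨q, hq, heq⟩ := hcon (-1) (by norm_num)
  have hsub : uIcc p q ⊆ Ici 0 := fun r hr => (le_min hp hq).trans hr.1
  obtain ⟨r, hr, her⟩ := intermediate_value_uIcc (hc.mono hsub)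
    (show (0 : ℝ) ∈ uIcc (e p) (e q) from
      mem_uIcc.2 (Or.inl ⟨by linarith, by linarith⟩))
  have hzero : ∀ t, r ≤ t → e t = 0 := fun t ht => by
    have := ha (hsub hr) (show (0 : ℝ) ≤ t from le_trans (hsub hr) ht) ht
    simpa [her] using this
  rcases mem_uIcc.1 hr with h | h
  · linarith [hzero q h.2]
  · linarith [hzero p h.2]

/-- Bounds for the weights of a sigmoid chain along which the squared residual is nonincreasing and
consecutive gradient components `g k` are related by backpropagation. -/
theorem exists_bound_of_chain (n : ℕ) (x y : ℝ) (W g A : ℕ → ℝ → ℝ)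
    (hW : ∀ k ≤ n + 1, ∀ t ≥ (0 : ℝ), HasDerivWithinAt (W k) (-g k t) (Ici 0) t)
    (hA₀ : ∀ t, A 0 t = x) (hA : ∀ k t, A (k + 1) t = sigmoid (W k t * A k t))
    (hlast : ∀ t, g (n + 1) t = (W (n + 1) t * A (n + 1) t - y) * A (n + 1) t)
    (hg : ∀ k ≤ n, ∀ t, g k t = (1 - A (k + 1) t) * A k t * W (k + 1) t * g (k + 1) t)
    (hc : ContinuousOn (fun t => W (n + 1) t * A (n + 1) t - y) (Ici 0))
    (he : AntitoneOn (fun t => |W (n + 1) t * A (n + 1) t - y|) (Ici 0)) :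
    ∀ k ≤ n + 1, ∃ C, ∀ t ≥ (0 : ℝ), |W k t| ≤ C := by
  have hApos : ∀ k t, 0 < A (k + 1) t := fun k t => hA k t ▸ sigmoid_pos _
  have hAlt : ∀ k t, A (k + 1) t < 1 := fun k t => hA k t ▸ sigmoid_lt_one _
  obtain ⟨s, hs, hse⟩ := exists_sign_of_antitoneOn_abs hc he
  have hsabs : |s| = 1 := by
    rw [← sq_eq_sq₀ (abs_nonneg s) zero_le_one, sq_abs, hs, one_pow]
  set u : ℝ → ℝ := fun t => -s * W (n + 1) t with hu
  set u' : ℝ → ℝ := fun t => s * g (n + 1) t with hu'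
  have hud : ∀ t ≥ (0 : ℝ), HasDerivWithinAt u (u' t) (Ici 0) t := fun t ht => by
    refine ((hW (n + 1) le_rfl t ht).const_mul (-s)).congr_deriv ?_
    simp only [hu']
    ring
  have hu'0 : ∀ t ≥ (0 : ℝ), 0 ≤ u' t := fun t ht => by
    simp only [hu', hlast, ← mul_assoc]
    exact mul_nonneg (hse t ht) (hApos n t).le
  have huabs : ∀ t, |u t| = |W (n + 1) t| := fun t => by
    simp only [hu, abs_mul, abs_neg, hsabs, one_mul]
  have hu'abs : ∀ t ≥ (0 : ℝ), |g (n + 1) t| = u' t := fun t ht => by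
    rw [← abs_of_nonneg (hu'0 t ht)]
    simp only [hu', abs_mul, hsabs, one_mul]
  have hmono : MonotoneOn u (Ici 0) := monotoneOn_of_hasDerivWithinAt_Ici hud hu'0
  have hgn : ∀ t, -g n t = A n t * ((1 - A (n + 1) t) * (u t * u' t)) := fun t => by
    rw [hg n le_rfl t]
    simp only [hu, hu']
    linear_combination (1 - A (n + 1) t) * A n t * W (n + 1) t * g (n + 1) t * hs
  have hbdd : ∃ B, ∀ t ≥ (0 : ℝ), u t ≤ B := by
    by_cases hT : ∀ t ≥ (0 : ℝ), u t ≤ 0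
    · exact ⟨0, hT⟩
    push Not at hT
    obtain ⟨T, hT0, huT⟩ := hT
    have hsub : Ici T ⊆ Ici (0 : ℝ) := Ici_subset_Ici.2 hT0
    have hWn : ∀ t ≥ T, HasDerivWithinAt (W n)
        (A n t * ((1 - A (n + 1) t) * (u t * u' t))) (Ici T) t := fun t ht => by
      rw [← hgn]
      exact (hW n (by omega) t (hT0.trans ht)).mono hsub
    have hpos : ∀ t ≥ T, 0 ≤ (1 - A (n + 1) t) * (u t * u' t) := fun t ht =>
      mul_nonneg (by linarith [hAlt n t]) (mul_nonneg
        (huT.le.trans (hmono hT0 (hT0.trans ht) ht)) (hu'0 t (hT0.trans ht)))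
    have hz : ∃ b, ∀ t ≥ T, b ≤ W n t * A n t := by
      rcases n with _ | n
      · refine ⟨x * W 0 T, fun t ht => ?_⟩
        have := monotoneOn_of_hasDerivWithinAt_Ici
          (fun t ht => (hWn t ht).const_mul x) (fun t ht => by
            rw [hA₀, ← mul_assoc]
            exact mul_nonneg (mul_self_nonneg x) (hpos t ht)) self_mem_Ici ht ht
        rw [hA₀]
        linarith
      · refine ⟨-|W (n + 1) T|, fun t ht => ?_⟩
        have := monotoneOn_of_hasDerivWithinAt_Ici hWn
          (fun t ht => mul_nonneg (hApos n t).le (hpos t ht)) self_mem_Ici ht ht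
        have h1 := hApos n t
        have h2 := hAlt n t
        nlinarith [neg_abs_le (W (n + 1) T), abs_nonneg (W (n + 1) T)]
    obtain ⟨b, hb⟩ := hz
    set K := |W (n + 1) 0 * A (n + 1) 0 - y| + |y| with hK
    refine ⟨max (u T) (K / sigmoid b), fun t ht => ?_⟩
    rcases le_total t T with htT | htT
    · exact (hmono ht hT0 htT).trans (le_max_left _ _)
    refine le_trans ?_ (le_max_right _ _)
    rw [le_div_iff₀ (sigmoid_pos b)]
    have hut : 0 ≤ u t := huT.le.trans (hmono hT0 ht htT)
    calc u t * sigmoid b ≤ u t * A (n + 1) t := by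
          rw [hA]
          exact mul_le_mul_of_nonneg_left (sigmoid_le_sigmoid (hb t htT)) hut
      _ = |W (n + 1) t * A (n + 1) t| := by
          rw [abs_mul, ← huabs, abs_of_nonneg hut, abs_of_pos (hApos n t)]
      _ ≤ |W (n + 1) t * A (n + 1) t - y| + |y| := by
          simpa using abs_add_le (W (n + 1) t * A (n + 1) t - y) y
      _ ≤ K := by
          have := he self_mem_Ici ht ht
          simp only at this
          linarith
  obtain ⟨B, hB⟩ := hbdd
  have hgC : ∀ k C, k ≤ n + 1 → 0 ≤ C → (∀ t ≥ (0 : ℝ), |g k t| ≤ C * u' t) →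
      ∀ t ≥ (0 : ℝ), |W k t| ≤ |W k 0| + C * (B - u 0) := fun k C hk hC hgk t ht => by
    have h1 := abs_sub_le_of_abs_deriv_le (hW k hk) hud
      (fun t ht => by rw [abs_neg]; exact hgk t ht) ht
    have h2 := abs_add_le (W k 0) (W k t - W k 0)
    have h3 := mul_le_mul_of_nonneg_left (sub_le_sub_right (hB t ht) (u 0)) hC
    rw [add_sub_cancel] at h2
    linarith
  have hAabs : ∀ k t, |A k t| ≤ |x| + 1 := fun k t => by
    rcases k with _ | k
    · rw [hA₀]
      linarith
    · rw [abs_of_pos (hApos k t)]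
      linarith [hAlt k t, abs_nonneg x]
  have hgbound : ∀ k ≤ n + 1, ∃ C, 0 ≤ C ∧ ∀ t ≥ (0 : ℝ), |g k t| ≤ C * u' t := by
    intro k hk
    induction hk using Nat.decreasingInduction with
    | self => exact ⟨1, zero_le_one, fun t ht => by rw [hu'abs t ht, one_mul]⟩
    | of_succ k hk ih =>
      obtain ⟨C, hC, hgk⟩ := ih
      set D := |W (k + 1) 0| + C * (B - u 0) with hD
      have hWD : ∀ t ≥ (0 : ℝ), |W (k + 1) t| ≤ D := hgC (k + 1) C (by omega) hC hgk
      have hD0 : 0 ≤ D := (abs_nonneg _).trans (hWD 0 le_rfl)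
      refine ⟨(|x| + 1) * D * C, by positivity, fun t ht => ?_⟩
      rw [hg k (by omega) t, abs_mul, abs_mul, abs_mul, mul_assoc _ C]
      have h1 : |1 - A (k + 1) t| ≤ 1 := by
        rw [abs_le]
        constructor <;> linarith [hApos k t, hAlt k t]
      calc |1 - A (k + 1) t| * |A k t| * |W (k + 1) t| * |g (k + 1) t|
          ≤ 1 * (|x| + 1) * D * (C * u' t) := by
            gcongr
            exacts [hAabs k t, hWD t ht, hgk t ht]
        _ = (|x| + 1) * D * (C * u' t) := by ring
  intro k hk
  obtain ⟨C, hC, hgk⟩ := hgbound k hk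
  exact ⟨_, hgC k C hk hC hgk⟩

theorem gradient_apply {L : ℕ} (f : EuclideanSpace ℝ (Fin L) → ℝ) (w : EuclideanSpace ℝ (Fin L))
    (i : Fin L) : gradient f w i = fderiv ℝ f w (EuclideanSpace.single i 1) := by
  rw [← InnerProductSpace.toDual_symm_apply (𝕜 := ℝ), EuclideanSpace.inner_single_right]
  simp [gradient]

/-- A differentiable function is nonincreasing along its gradient trajectories. -/
theorem antitoneOn_comp_of_gradient_flow {E : Type*} [NormedAddCommGroup E]
    [InnerProductSpace ℝ E] [CompleteSpace E] {f : E → ℝ} (hf : Differentiable ℝ f) {w : ℝ → E}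
    (hw : ∀ t ≥ (0 : ℝ), HasDerivWithinAt w (-gradient f (w t)) (Ici 0) t) :
    AntitoneOn (f ∘ w) (Ici 0) := by
  have h := monotoneOn_of_hasDerivWithinAt_Ici
    (fun t ht => ((hf (w t)).hasFDerivAt.comp_hasDerivWithinAt t (hw t ht)).neg)
    (fun t _ => by
      rw [map_neg, neg_neg, ← InnerProductSpace.toDual_symm_apply (𝕜 := ℝ)]
      exact real_inner_self_nonneg)
  exact fun a ha b hb hab => neg_le_neg_iff.1 (h ha hb hab)

/-- Proposition 4.2: the loss of a one-dimensional deep sigmoid network with one data point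
`(x,y)`, `f(w₁,…,w_L) = (1/2)(w_L σ(w_{L−1} ⋯ σ(w₁x)) − y)²`, has bounded gradient
trajectories. -/
theorem stmt8 (L : ℕ) (hL : 2 ≤ L) (x y : ℝ)
    (f : EuclideanSpace ℝ (Fin L) → ℝ)
    (hf : ∀ w, f w = (1 / 2) * (w ⟨L - 1, by omega⟩ * sigHidden L x w (L - 1) - y) ^ 2)
    (w : ℝ → EuclideanSpace ℝ (Fin L))
    (hw : ∀ t ≥ (0:ℝ), HasDerivWithinAt w (-gradient f (w t)) (Set.Ici 0) t) :
    ∃ r > 0, ∀ t ≥ (0:ℝ), ‖w t‖ ≤ r := by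
  obtain ⟨n, rfl⟩ : ∃ n, L = n + 2 := ⟨L - 2, by omega⟩
  have hf' : ∀ v, f v = (1 / 2) * (preact (n + 2) x (n + 1) v - y) ^ 2 := fun v => by
    rw [hf, preact, weight_apply (by omega)]
    rfl
  have hp := differentiable_preact (n + 2) x (n + 1)
  have hfd : ∀ v, HasFDerivAt f ((preact (n + 2) x (n + 1) v - y) •
      fderiv ℝ (preact (n + 2) x (n + 1)) v) v := fun v => by
    rw [funext hf']
    refine ((((hp v).hasFDerivAt.sub_const y).pow 2).const_mul (1 / 2)).congr_fderiv ?_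
    ext h
    simp
    ring
  have hgrad : ∀ v i, gradient f v i = (preact (n + 2) x (n + 1) v - y) *
      fderiv ℝ (preact (n + 2) x (n + 1)) v (EuclideanSpace.single i 1) := fun v i => by
    rw [gradient_apply, (hfd v).fderiv]
    simp
  have hanti := antitoneOn_comp_of_gradient_flow (fun v => (hfd v).differentiableAt) hw
  have hcont : ContinuousOn w (Ici 0) := fun t ht => (hw t ht).continuousWithinAt
  have hbound := exists_bound_of_chain n x y (fun k t => weight (n + 2) k (w t))
    (fun k t => weight (n + 2) k (gradient f (w t))) (fun k t => sigHidden (n + 2) x (w t) k)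
    (fun k _ t ht => by
      rw [← map_neg]
      exact (weight (n + 2) k).hasFDerivAt.comp_hasDerivWithinAt t (hw t ht))
    (fun _ => rfl) (fun k t => sigHidden_succ _ _ _ _)
    (fun t => by
      simp only [weight_apply (show n + 1 < n + 2 by omega) (gradient f _), hgrad,
        fderiv_preact_single_self]
      rfl)
    (fun k hk t => by
      simp only [weight_apply (show k < n + 2 by omega) (gradient f _),
        weight_apply (show k + 1 < n + 2 by omega) (gradient f _), hgrad]
      rw [fderiv_preact_single _ x k (n + 1) (by omega) (by omega)]
      ring)
    ((hp.continuous.comp_continuousOn hcont).sub continuousOn_const)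
    (fun a ha b hb hab => by
      have := hanti ha hb hab
      simp only [Function.comp_apply, hf'] at this
      exact sq_le_sq.1 (by unfold preact at this; linarith))
  choose! C hC using hbound
  refine ⟨√(∑ i : Fin (n + 2), C i ^ 2) + 1, by positivity, fun t ht => ?_⟩
  rw [EuclideanSpace.norm_eq]
  refine le_trans (Real.sqrt_le_sqrt (Finset.sum_le_sum fun i _ => ?_))
    (le_add_of_nonneg_right zero_le_one)
  have h := hC i (by omega) t ht
  rw [weight_apply i.isLt] at h
  exact pow_le_pow_left₀ (norm_nonneg _) h 2
end

section
/- Let L ≥ 2, x, y ∈ ℝ, σ(z) := (1 + e^{−z})^{−1}, and define f(w₁,…,w_L) := (w_L σ(w_{L−1} σ(⋯ σ(w₁ x) ⋯)) − y)² on ℝ^L. Then inf_{ℝ^L} f = 0, and every setwise local minimum S of f satisfies inf_S f = 0. In particular, f has no spurious setwise local minima and no spurious local minima at infinity. -/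
open Set

/-- The `m`-th hidden activation depends only on the first `m` weights. -/
theorem sigHidden_congr {L : ℕ} (x : ℝ) {v w : EuclideanSpace ℝ (Fin L)} (m : ℕ)
    (h : ∀ i : Fin L, (i : ℕ) < m → v i = w i) : sigHidden L x v m = sigHidden L x w m := by
  induction m with
  | zero => rfl
  | succ k ih =>
    have hk := ih fun i hi => h i (hi.trans k.lt_succ_self)
    by_cases hkL : k < L
    · simp [sigHidden, hk, hkL, h ⟨k, hkL⟩ k.lt_succ_self]
    · simp [sigHidden, hkL]

/-- If, along a path starting in a setwise local minimum, the objective strictly decreases on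
`[0, 1]`, then the path stays in the set up to time `1`. -/
theorem SetwiseLocalMin.path_one_mem {E : Type*} [TopologicalSpace E] {f : E → ℝ} {S : Set E}
    (hS : SetwiseLocalMin f S) {γ : ℝ → E} (hγ : Continuous γ) (h0 : γ 0 ∈ S)
    (hanti : StrictAntiOn (f ∘ γ) (Icc 0 1)) : γ 1 ∈ S := by
  obtain ⟨-, hcl, U, hU, hSU, hle⟩ := hS
  have hcl' : IsClosed (γ ⁻¹' S ∩ Icc 0 1) := (hcl.preimage hγ).inter isClosed_Icc
  refine hcl'.Icc_subset_of_forall_exists_gt h0 ?_ (right_mem_Icc.2 zero_le_one)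
  rintro t ⟨htS, ht⟩ y hy
  have hnear : ∀ᶠ s in nhdsWithin t (Ioi t), γ s ∈ U :=
    nhdsWithin_le_nhds ((hU.preimage hγ).mem_nhds (hSU htS))
  have hIoc : ∀ᶠ s in nhdsWithin t (Ioi t), s ∈ Ioc t (min y 1) :=
    Ioc_mem_nhdsGT (lt_min hy ht.2)
  obtain ⟨s, hsU, hts, hs⟩ := (hnear.and hIoc).exists
  refine ⟨s, ?_, hts, hs.trans (min_le_left _ _)⟩
  by_contra hsS
  exact (hanti ⟨ht.1, ht.2.le⟩ ⟨ht.1.trans hts.le, hs.trans (min_le_right _ _)⟩ hts).not_ge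
    (hle _ htS _ ⟨hsU, hsS⟩)

/-- Corollary 1.2, part 2: the loss of a one-dimensional deep sigmoid network with one data
point `(x,y)`, `f(w₁,…,w_L) = (w_L σ(w_{L−1} ⋯ σ(w₁x)) − y)²`, has infimum `0` and every
setwise local minimum `S` of `f` satisfies `inf_S f = 0`; in particular `f` has no spurious
setwise local minima and no spurious local minima at infinity. -/
theorem stmt14 (L : ℕ) (hL : 2 ≤ L) (x y : ℝ)
    (f : EuclideanSpace ℝ (Fin L) → ℝ)
    (hf : ∀ w, f w = (w ⟨L - 1, by omega⟩ * sigHidden L x w (L - 1) - y) ^ 2) :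
    sInf (Set.range f) = 0 ∧
      ∀ S : Set (EuclideanSpace ℝ (Fin L)), SetwiseLocalMin f S → sInf (f '' S) = 0 := by
  have key : ∀ S : Set (EuclideanSpace ℝ (Fin L)), SetwiseLocalMin f S → sInf (f '' S) = 0 := by
    intro S hS
    suffices hz : ∃ q ∈ S, f q = 0 by
      obtain ⟨q, hq, hq0⟩ := hz
      refine IsLeast.csInf_eq ⟨⟨q, hq, hq0⟩, ?_⟩
      rintro _ ⟨w, -, rfl⟩
      rw [hf]
      positivity
    obtain ⟨p, hp⟩ := hS.1
    by_cases hp0 : f p = 0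
    · exact ⟨p, hp, hp0⟩
    have hfp : 0 < f p := lt_of_le_of_ne (by rw [hf]; positivity) (Ne.symm hp0)
    set a : Fin L := ⟨L - 1, by omega⟩ with ha
    set h := sigHidden L x p (L - 1) with hh
    have hpos : 0 < h := by
      obtain ⟨k, hk⟩ : ∃ k, L - 1 = k + 1 := ⟨L - 2, by omega⟩
      rw [hh, hk]
      exact sigmoid_pos _
    let γ : ℝ → EuclideanSpace ℝ (Fin L) := fun t =>
      p + t • EuclideanSpace.single a (y / h - p a)
    have hγ : Continuous γ := by fun_prop
    have hfγ (t : ℝ) : f (γ t) = (1 - t) ^ 2 * f p := by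
      have hid : sigHidden L x (γ t) (L - 1) = h := by
        refine sigHidden_congr x _ fun i hi => ?_
        have hia : i ≠ a := by
          rintro rfl
          exact lt_irrefl _ hi
        simp [γ, hia]
      have hγa : γ t a = p a + t * (y / h - p a) := by simp [γ]
      rw [hf, hf, hid, hγa, ← hh]
      field_simp
      ring
    refine ⟨γ 1, hS.path_one_mem hγ (by simpa [γ] using hp) ?_, by simp [hfγ]⟩
    intro s hs t ht hst
    simp only [Function.comp_apply, hfγ]
    have := ht.2
    gcongr
  refine ⟨?_, key⟩
  rw [← image_univ]
  exact key univ ⟨⟨0, mem_univ _⟩, isClosed_univ, univ, isOpen_univ, Subset.rfl, by simp⟩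
end

section
/- Let m, n be positive integers and M ∈ ℝ^{m×n} be a rank-one matrix all of whose entries M_{ij} are nonzero. Define f(x,y) := Σ_{i=1}^m Σ_{j=1}^n |x_i y_j − M_{ij}| for x ∈ ℝ^m, y ∈ ℝ^n. Then inf f = 0 and every setwise local minimum S of f satisfies inf_S f = 0; in particular, f has no spurious setwise local minima and no spurious local minima at infinity. -/
open Set

open Topology Filter

theorem IsPreconnected.subset_of_disjoint_frontier {E : Type*} [TopologicalSpace E] {C S : Set E}
    (hC : IsPreconnected C) (hCS : (C ∩ S).Nonempty) (hd : Disjoint C (frontier S)) : C ⊆ S := by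
  have hsub : C ⊆ interior S ∪ (closure S)ᶜ := by
    intro w hw
    by_cases h : w ∈ interior S
    · exact Or.inl h
    · exact Or.inr fun hcl => hd.le_bot ⟨hw, hcl, h⟩
  obtain ⟨q, hqC, hqS⟩ := hCS
  have hq : q ∈ interior S := by
    rcases hsub hqC with h | h
    · exact h
    · exact absurd (subset_closure hqS) h
  refine (hC.subset_left_of_subset_union isOpen_interior isClosed_closure.isOpen_compl ?_ hsub
    ⟨q, hqC, hq⟩).trans interior_subset
  exact disjoint_compl_right.mono_left (interior_subset.trans subset_closure)

/-- If every local minimum of a continuous `f` has value zero, and every point is connected to a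
zero of `f` inside its own sublevel set, then setwise local minima contain zeros of `f`. -/
theorem SetwiseLocalMin.exists_eq_zero {E : Type*} [TopologicalSpace E] [PreconnectedSpace E]
    {f : E → ℝ} (hf : Continuous f) (hmin : ∀ z, IsLocalMin f z → f z = 0)
    (hconn : ∀ z, ∃ C, IsPreconnected C ∧ z ∈ C ∧ (∀ w ∈ C, f w ≤ f z) ∧ ∃ w ∈ C, f w = 0)
    {S : Set E} (hS : SetwiseLocalMin f S) : ∃ w ∈ S, f w = 0 := by
  obtain ⟨hne, hcl, U, hU, hSU, hle⟩ := hS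
  rcases (frontier S).eq_empty_or_nonempty with hfr | ⟨p, hp⟩
  · rcases frontier_eq_empty_iff.1 hfr with rfl | rfl
    · exact absurd hne Set.not_nonempty_empty
    · obtain ⟨z, -⟩ := hne
      obtain ⟨C, -, -, -, w, -, hw⟩ := hconn z
      exact ⟨w, mem_univ w, hw⟩
  have hpS : p ∈ S := hcl.frontier_subset hp
  by_cases hp0 : f p = 0
  · exact ⟨p, hpS, hp0⟩
  have hfrontier : ∀ q ∈ frontier S, f p ≤ f q := by
    intro q hq
    have hqU : q ∈ U := hSU (hcl.frontier_subset hq)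
    have hqc : q ∈ closure (U ∩ Sᶜ) := by
      refine hU.inter_closure ⟨hqU, ?_⟩
      rw [frontier_eq_closure_inter_closure] at hq
      exact hq.2
    exact closure_minimal (fun y hy => hle p hpS y hy) (isClosed_le continuous_const hf) hqc
  have hnot : ∃ᶠ q in 𝓝 p, ¬ f p ≤ f q := fun h => hp0 (hmin p (by simpa [IsLocalMin, IsMinFilter] using h))
  obtain ⟨q, hqlt, hqU⟩ := (hnot.and_eventually (hU.mem_nhds (hSU hpS))).exists
  have hqS : q ∈ S := by
    by_contra h
    exact hqlt (hle p hpS q ⟨hqU, h⟩)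
  obtain ⟨C, hC, hqC, hCle, w, hwC, hw⟩ := hconn q
  refine ⟨w, hC.subset_of_disjoint_frontier ⟨q, hqC, hqS⟩ ?_ hwC, hw⟩
  exact Set.disjoint_left.2 fun v hvC hv => hqlt ((hfrontier v hv).trans (hCle v hvC))

/-- The weighted `ℓ¹` loss of fitting a row of ones by the multiple `t • y`. -/
def rowLoss {κ : Type*} [Fintype κ] (β y : κ → ℝ) (t : ℝ) : ℝ := ∑ j, β j * |t * y j - 1|

/-- The weighted `ℓ¹` loss of fitting the all-ones matrix by the product of `x` and `y`. -/
def rankOneLoss {ι κ : Type*} [Fintype ι] [Fintype κ] (α : ι → ℝ) (β : κ → ℝ)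
    (x : ι → ℝ) (y : κ → ℝ) : ℝ :=
  ∑ i, α i * rowLoss β y (x i)

section RankOneLoss

variable {ι κ : Type*} [Fintype ι] [Fintype κ] {α : ι → ℝ} {β : κ → ℝ}

theorem rankOneLoss_eq_sum (α : ι → ℝ) (β : κ → ℝ) (x : ι → ℝ) (y : κ → ℝ) :
    rankOneLoss α β x y = ∑ i, ∑ j, α i * β j * |x i * y j - 1| := by
  simp only [rankOneLoss, rowLoss, Finset.mul_sum, mul_assoc]

theorem rankOneLoss_comm (α : ι → ℝ) (β : κ → ℝ) (x : ι → ℝ) (y : κ → ℝ) :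
    rankOneLoss α β x y = rankOneLoss β α y x := by
  rw [rankOneLoss_eq_sum, rankOneLoss_eq_sum, Finset.sum_comm]
  simp only [mul_comm (α _) (β _), mul_comm (x _) (y _)]

theorem convexOn_rowLoss (hβ : ∀ j, 0 < β j) (y : κ → ℝ) :
    ConvexOn ℝ univ (rowLoss β y) := by
  refine ⟨convex_univ, fun s _ t _ a b ha hb hab => ?_⟩
  simp only [rowLoss, smul_eq_mul, Finset.mul_sum, ← Finset.sum_add_distrib]
  refine Finset.sum_le_sum fun j _ => ?_
  have h : (a * s + b * t) * y j - 1 = a * (s * y j - 1) + b * (t * y j - 1) := by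
    linear_combination hab
  have h2 := abs_add_le (a * (s * y j - 1)) (b * (t * y j - 1))
  rw [abs_mul, abs_mul, abs_of_nonneg ha, abs_of_nonneg hb] at h2
  rw [h]
  nlinarith [hβ j]

theorem convexOn_rankOneLoss_left (hα : ∀ i, 0 < α i) (hβ : ∀ j, 0 < β j) (y : κ → ℝ) :
    ConvexOn ℝ univ (fun x => rankOneLoss α β x y) := by
  refine ⟨convex_univ, fun s _ t _ a b ha hb hab => ?_⟩
  simp only [rankOneLoss, smul_eq_mul, Finset.mul_sum, ← Finset.sum_add_distrib]
  refine Finset.sum_le_sum fun i _ => ?_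
  have h := (convexOn_rowLoss hβ y).2 (mem_univ (s i)) (mem_univ (t i)) ha hb hab
  simp only [smul_eq_mul, Pi.add_apply, Pi.smul_apply] at h ⊢
  nlinarith [hα i]

theorem convexOn_rankOneLoss_right (hα : ∀ i, 0 < α i) (hβ : ∀ j, 0 < β j) (x : ι → ℝ) :
    ConvexOn ℝ univ (fun y => rankOneLoss α β x y) := by
  simpa only [rankOneLoss_comm α β x] using convexOn_rankOneLoss_left hβ hα x

theorem continuous_rankOneLoss (α : ι → ℝ) (β : κ → ℝ) :
    Continuous fun p : (ι → ℝ) × (κ → ℝ) => rankOneLoss α β p.1 p.2 := by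
  simp only [rankOneLoss_eq_sum]
  fun_prop

theorem rankOneLoss_eq_zero_of_mul_eq_one {x : ι → ℝ} {y : κ → ℝ}
    (h : ∀ i j, x i * y j = 1) : rankOneLoss α β x y = 0 := by
  simp [rankOneLoss_eq_sum, h]

theorem rankOneLoss_eq_of_sign {x : ι → ℝ} {y : κ → ℝ} {σ : ℝ}
    (h : ∀ i j, |x i * y j - 1| = σ * (x i * y j - 1)) :
    rankOneLoss α β x y =
      σ * ((∑ i, α i * x i) * (∑ j, β j * y j) - (∑ i, α i) * ∑ j, β j) := by
  rw [Finset.sum_mul_sum, Finset.sum_mul_sum, rankOneLoss_eq_sum]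
  simp only [h, ← Finset.sum_sub_distrib]
  simp only [Finset.mul_sum]
  exact Finset.sum_congr rfl fun i _ => Finset.sum_congr rfl fun j _ => by ring

/-- On the region where all residuals have the same strict sign, the loss is a saddle. -/
theorem not_isLocalMin_of_sign [Nonempty ι] [Nonempty κ]
    (hα : ∀ i, 0 < α i) (hβ : ∀ j, 0 < β j) {x : ι → ℝ} {y : κ → ℝ} {σ : ℝ}
    (hσ : σ = 1 ∨ σ = -1) (h : ∀ i j, 0 < σ * (x i * y j - 1)) :
    ¬ IsLocalMin (fun p : (ι → ℝ) × (κ → ℝ) => rankOneLoss α β p.1 p.2) (x, y) := by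
  intro hloc
  have habs : ∀ r : ℝ, 0 < σ * r → |r| = σ * r := by
    intro r hr
    rcases hσ with rfl | rfl
    · rw [abs_of_pos (by linarith)]; ring
    · rw [abs_of_neg (by linarith)]; ring
  have hA : 0 < ∑ i, α i := Finset.sum_pos (fun i _ => hα i) Finset.univ_nonempty
  have hB : 0 < ∑ j, β j := Finset.sum_pos (fun j _ => hβ j) Finset.univ_nonempty
  have hc : Tendsto (fun p : ℝ × ℝ => ((fun i => x i + p.1, fun j => y j + p.2) :
      (ι → ℝ) × (κ → ℝ))) (𝓝 (0, 0)) (𝓝 (x, y)) := by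
    refine Continuous.tendsto' (by fun_prop) _ _ (by simp)
  have hsign : ∀ᶠ p : ℝ × ℝ in 𝓝 (0, 0), ∀ i j, 0 < σ * ((x i + p.1) * (y j + p.2) - 1) := by
    refine eventually_all.2 fun i => eventually_all.2 fun j => ?_
    have : Tendsto (fun p : ℝ × ℝ => σ * ((x i + p.1) * (y j + p.2) - 1)) (𝓝 (0, 0))
        (𝓝 (σ * (x i * y j - 1))) := Continuous.tendsto' (by fun_prop) _ _ (by simp)
    exact this.eventually_const_lt (h i j)
  set A := ∑ i, α i
  set B := ∑ j, β j
  set X := ∑ i, α i * x i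
  set Y := ∑ j, β j * y j
  have hev : ∀ᶠ p : ℝ × ℝ in 𝓝 (0, 0),
      0 ≤ σ * (p.1 * A * Y + p.2 * B * X + p.1 * p.2 * A * B) := by
    filter_upwards [hc.eventually hloc, hsign] with p hp hs
    rw [rankOneLoss_eq_of_sign (fun i j => habs _ (h i j)),
      rankOneLoss_eq_of_sign (σ := σ) (fun i j => habs _ (hs i j))] at hp
    simp only [mul_add, Finset.sum_add_distrib, ← Finset.sum_mul] at hp
    linarith
  obtain ⟨r, hr, hball⟩ := Metric.eventually_nhds_iff_ball.1 hev
  have hmem : ∀ a b : ℝ, |a| < r → |b| < r → (a, b) ∈ Metric.ball ((0, 0) : ℝ × ℝ) r := by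
    intro a b ha hb
    rw [Metric.mem_ball, dist_eq_norm]
    simp [Prod.norm_def, ha, hb]
  have habs2 : |r / 2| < r := by rw [abs_of_pos (by linarith)]; linarith
  have habs3 : |-(r / 2)| < r := by rwa [abs_neg]
  have habs0 : |(0 : ℝ)| < r := by simpa using hr
  have h1 := hball _ (hmem (r / 2) 0 habs2 habs0)
  have h2 := hball _ (hmem (-(r / 2)) 0 habs3 habs0)
  have h3 := hball _ (hmem 0 (r / 2) habs0 habs2)
  have h4 := hball _ (hmem 0 (-(r / 2)) habs0 habs3)
  have h5 := hball _ (hmem (r / 2) (r / 2) habs2 habs2)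
  have h6 := hball _ (hmem (r / 2) (-(r / 2)) habs2 habs3)
  have hpos : 0 < (r / 2) * (r / 2) * A * B := by positivity
  rcases hσ with rfl | rfl <;> simp only at h1 h2 h3 h4 h5 h6 <;> linarith

theorem rowLoss_le_of_isLocalMin (hα : ∀ i, 0 < α i) (hβ : ∀ j, 0 < β j) {x : ι → ℝ} {y : κ → ℝ}
    (hloc : IsLocalMin (fun x' => rankOneLoss α β x' y) x) (i : ι) (t : ℝ) :
    rowLoss β y (x i) ≤ rowLoss β y t := by
  classical
  have h := IsMinOn.of_isLocalMin_of_convex_univ hloc (convexOn_rankOneLoss_left hα hβ y)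
    (Function.update x i t)
  simp only [rankOneLoss] at h
  rw [← Finset.add_sum_erase _ _ (Finset.mem_univ i),
    ← Finset.add_sum_erase _ _ (Finset.mem_univ i)] at h
  have hcongr : ∑ k ∈ Finset.univ.erase i, α k * rowLoss β y (Function.update x i t k) =
      ∑ k ∈ Finset.univ.erase i, α k * rowLoss β y (x k) :=
    Finset.sum_congr rfl fun k hk => by rw [Function.update_of_ne (Finset.ne_of_mem_erase hk)]
  rw [hcongr, Function.update_self] at h
  exact le_of_mul_le_mul_left (by linarith) (hα i)

/-- Between two minimizers of the row loss no residual vanishes. -/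
theorem mul_ne_one_of_rowLoss_le (hβ : ∀ j, 0 < β j) {y : κ → ℝ} {a b t : ℝ}
    (ha : ∀ s, rowLoss β y a ≤ rowLoss β y s) (hb : ∀ s, rowLoss β y b ≤ rowLoss β y s)
    (ht : t ∈ Ioo a b) (j : κ) : t * y j - 1 ≠ 0 := by
  intro hj
  obtain ⟨hat, htb⟩ := ht
  have hlt : (b - a) * rowLoss β y t < (b - t) * rowLoss β y a + (t - a) * rowLoss β y b := by
    simp only [rowLoss, Finset.mul_sum, ← Finset.sum_add_distrib]
    refine Finset.sum_lt_sum (fun k _ => ?_) ⟨j, Finset.mem_univ j, ?_⟩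
    · have h := abs_add_le ((b - t) * (a * y k - 1)) ((t - a) * (b * y k - 1))
      have he : (b - t) * (a * y k - 1) + (t - a) * (b * y k - 1) = (b - a) * (t * y k - 1) := by
        ring
      rw [he, abs_mul, abs_mul, abs_mul, abs_of_pos (by linarith : 0 < b - a),
        abs_of_pos (by linarith : 0 < b - t), abs_of_pos (by linarith : 0 < t - a)] at h
      nlinarith [hβ k]
    · have hy : y j ≠ 0 := by rintro h0; simp [h0] at hj
      have hne : a * y j - 1 ≠ 0 := by
        intro h
        have : (t - a) * y j = 0 := by linarith
        rcases mul_eq_zero.1 this with h | h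
        · linarith
        · exact hy h
      have h1 : 0 < (b - t) * (β j * |a * y j - 1|) :=
        mul_pos (by linarith) (mul_pos (hβ j) (abs_pos.2 hne))
      have h2 : 0 ≤ (t - a) * (β j * |b * y j - 1|) :=
        mul_nonneg (by linarith) (mul_nonneg (hβ j).le (abs_nonneg _))
      rw [hj, abs_zero]
      linarith
  have hba : rowLoss β y b ≤ rowLoss β y a := hb a
  nlinarith [ha t]

theorem residual_sign_of_rowLoss_le (hβ : ∀ j, 0 < β j) {y : κ → ℝ} {a b : ℝ}
    (ha : ∀ s, rowLoss β y a ≤ rowLoss β y s) (hb : ∀ s, rowLoss β y b ≤ rowLoss β y s) (j : κ) :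
    (∀ t ∈ Ioo a b, 0 < t * y j - 1) ∨ ∀ t ∈ Ioo a b, t * y j - 1 < 0 := by
  by_contra! h
  obtain ⟨⟨t, ht, ht0⟩, s, hs, hs0⟩ := h
  obtain ⟨u, hu, hu0⟩ := isPreconnected_Ioo.intermediate_value ht hs
    (f := fun t => t * y j - 1) (by fun_prop) ⟨ht0, hs0⟩
  exact mul_ne_one_of_rowLoss_le hβ ha hb hu j hu0

theorem frequently_rankOneLoss_eq_and_sign (hα : ∀ i, 0 < α i) (hβ : ∀ j, 0 < β j)
    {x : ι → ℝ} {y : κ → ℝ} (hloc : IsLocalMin (fun x' => rankOneLoss α β x' y) x)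
    (hx : ∃ i k, x i ≠ x k) :
    ∃ᶠ x' in 𝓝 x, rankOneLoss α β x' y = rankOneLoss α β x y ∧
      ∀ j, (∀ i, 0 < x' i * y j - 1) ∨ ∀ i, x' i * y j - 1 < 0 := by
  obtain ⟨i₀, k₀, hne⟩ := hx
  have : Nonempty ι := ⟨i₀⟩
  obtain ⟨k, hk⟩ := Finite.exists_min x
  obtain ⟨l, hl⟩ := Finite.exists_max x
  have hkl : x k < x l := by
    rcases lt_or_gt_of_ne hne with h | h
    · exact (hk i₀).trans_lt (h.trans_le (hl k₀))
    · exact (hk k₀).trans_lt (h.trans_le (hl i₀))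
  have hmin := rowLoss_le_of_isLocalMin hα hβ hloc
  have hT : Tendsto (fun ε : ℝ => fun i => x i + ε * ((x k + x l) / 2 - x i)) (𝓝[>] 0) (𝓝 x) :=
    (Continuous.tendsto' (by fun_prop) _ _ (by simp)).mono_left nhdsWithin_le_nhds
  refine hT.frequently (Eventually.frequently ?_)
  filter_upwards [Ioo_mem_nhdsGT (zero_lt_one' ℝ)] with ε hε
  have hmem : ∀ i, x i + ε * ((x k + x l) / 2 - x i) ∈ Ioo (x k) (x l) := by
    intro i
    constructor
    · nlinarith [mul_nonneg (sub_nonneg.2 (hk i)) (sub_nonneg.2 hε.2.le),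
        mul_pos hε.1 (sub_pos.2 hkl)]
    · nlinarith [mul_nonneg (sub_nonneg.2 (hl i)) (sub_nonneg.2 hε.2.le),
        mul_pos hε.1 (sub_pos.2 hkl)]
  refine ⟨?_, fun j => ?_⟩
  · refine Finset.sum_congr rfl fun i _ => ?_
    congr 1
    refine le_antisymm ?_ (hmin i _)
    have hseg := (convexOn_rowLoss hβ y).le_on_segment (mem_univ (x k)) (mem_univ (x l))
      (by rw [segment_eq_Icc hkl.le]; exact Ioo_subset_Icc_self (hmem i))
    exact hseg.trans (max_le (hmin k _) (hmin l _))
  · exact (residual_sign_of_rowLoss_le hβ (hmin k) (hmin l) j).imp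
      (fun h i => h _ (hmem i)) (fun h i => h _ (hmem i))

theorem rankOneLoss_nonneg (hα : ∀ i, 0 < α i) (hβ : ∀ j, 0 < β j) (x : ι → ℝ) (y : κ → ℝ) :
    0 ≤ rankOneLoss α β x y := by
  rw [rankOneLoss_eq_sum]
  exact Finset.sum_nonneg fun i _ => Finset.sum_nonneg fun j _ =>
    mul_nonneg (mul_pos (hα i) (hβ j)).le (abs_nonneg _)

theorem IsLocalMin.rankOneLoss_swap {x : ι → ℝ} {y : κ → ℝ}
    (hloc : IsLocalMin (fun p : (ι → ℝ) × (κ → ℝ) => rankOneLoss α β p.1 p.2) (x, y)) :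
    IsLocalMin (fun p : (κ → ℝ) × (ι → ℝ) => rankOneLoss β α p.1 p.2) (y, x) := by
  have h := hloc.comp_continuous (g := Prod.swap) (b := (y, x)) continuous_swap.continuousAt
  simpa only [Function.comp_def, Prod.fst_swap, Prod.snd_swap, rankOneLoss_comm α β] using h

theorem IsLocalMin.rankOneLoss_left {x : ι → ℝ} {y : κ → ℝ}
    (hloc : IsLocalMin (fun p : (ι → ℝ) × (κ → ℝ) => rankOneLoss α β p.1 p.2) (x, y)) :
    IsLocalMin (fun x' => rankOneLoss α β x' y) x :=
  hloc.comp_continuous (g := fun x' => (x', y)) (b := x) (by fun_prop)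

theorem IsLocalMin.rankOneLoss_right {x : ι → ℝ} {y : κ → ℝ}
    (hloc : IsLocalMin (fun p : (ι → ℝ) × (κ → ℝ) => rankOneLoss α β p.1 p.2) (x, y)) :
    IsLocalMin (fun y' => rankOneLoss α β x y') y :=
  hloc.comp_continuous (g := fun y' => (x, y')) (b := y) (by fun_prop)

theorem rankOneLoss_eq_zero_of_isLocalMin_const [Nonempty ι] [Nonempty κ]
    (hα : ∀ i, 0 < α i) (hβ : ∀ j, 0 < β j) {x : ι → ℝ} {y : κ → ℝ}
    (hloc : IsLocalMin (fun p : (ι → ℝ) × (κ → ℝ) => rankOneLoss α β p.1 p.2) (x, y))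
    (hx : ∀ i k, x i = x k) : rankOneLoss α β x y = 0 := by
  obtain ⟨k⟩ := ‹Nonempty ι›
  by_cases hk : x k = 0
  · exact absurd hloc (not_isLocalMin_of_sign (σ := -1) hα hβ (Or.inr rfl) fun i j => by
      simp [hx i k, hk])
  · refine le_antisymm ?_ (rankOneLoss_nonneg hα hβ x y)
    rw [← rankOneLoss_eq_zero_of_mul_eq_one (α := α) (β := β) (x := x) (y := fun _ => (x k)⁻¹)
      fun i j => by rw [hx i k, mul_inv_cancel₀ hk]]
    exact IsMinOn.of_isLocalMin_of_convex_univ hloc.rankOneLoss_right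
      (convexOn_rankOneLoss_right hα hβ x) _

theorem IsLocalMin.eventually_isLocalMin_of_eq {E : Type*} [TopologicalSpace E] {f : E → ℝ} {p : E}
    (h : IsLocalMin f p) : ∀ᶠ q in 𝓝 p, f q = f p → IsLocalMin f q := by
  filter_upwards [eventually_eventually_nhds.2 h] with q hq heq
  filter_upwards [hq] with r hr
  rwa [heq]

/-- The rank-one loss has no spurious local minima. -/
theorem rankOneLoss_eq_zero_of_isLocalMin [Nonempty ι] [Nonempty κ]
    (hα : ∀ i, 0 < α i) (hβ : ∀ j, 0 < β j) {x : ι → ℝ} {y : κ → ℝ}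
    (hloc : IsLocalMin (fun p : (ι → ℝ) × (κ → ℝ) => rankOneLoss α β p.1 p.2) (x, y)) :
    rankOneLoss α β x y = 0 := by
  by_cases hx : ∀ i k, x i = x k
  · exact rankOneLoss_eq_zero_of_isLocalMin_const hα hβ hloc hx
  push Not at hx
  have hcx : Tendsto (fun x' : ι → ℝ => (x', y)) (𝓝 x) (𝓝 (x, y)) :=
    Continuous.tendsto' (by fun_prop) _ _ rfl
  obtain ⟨x', ⟨heq, hcol⟩, hloc'⟩ :=
    ((frequently_rankOneLoss_eq_and_sign hα hβ hloc.rankOneLoss_left hx).and_eventually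
      (hcx.eventually hloc.eventually_isLocalMin_of_eq)).exists
  replace hloc' := hloc' heq
  rw [← heq]
  by_cases hy : ∀ j k, y j = y k
  · rw [rankOneLoss_comm]
    exact rankOneLoss_eq_zero_of_isLocalMin_const hβ hα hloc'.rankOneLoss_swap hy
  push Not at hy
  exfalso
  have hcy : Tendsto (fun y' : κ → ℝ => (x', y')) (𝓝 y) (𝓝 (x', y)) :=
    Continuous.tendsto' (by fun_prop) _ _ rfl
  have hcol' : ∀ᶠ y' in 𝓝 y, ∀ j, (∀ i, 0 < x' i * y' j - 1) ∨ ∀ i, x' i * y' j - 1 < 0 := by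
    refine eventually_all.2 fun j => ?_
    have hT : ∀ i, Tendsto (fun y' : κ → ℝ => x' i * y' j - 1) (𝓝 y) (𝓝 (x' i * y j - 1)) :=
      fun i => Continuous.tendsto' (by fun_prop) _ _ rfl
    rcases hcol j with h | h
    · exact (eventually_all.2 fun i => (hT i).eventually_const_lt (h i)).mono fun _ => Or.inl
    · exact (eventually_all.2 fun i => (hT i).eventually_lt_const (h i)).mono fun _ => Or.inr
  obtain ⟨y', ⟨heq', hrow⟩, hloc'', hcol''⟩ :=
    ((frequently_rankOneLoss_eq_and_sign hβ hα hloc'.rankOneLoss_swap.rankOneLoss_left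
      hy).and_eventually ((hcy.eventually hloc'.eventually_isLocalMin_of_eq).and hcol')).exists
  rw [rankOneLoss_comm, rankOneLoss_comm β α] at heq'
  replace hloc'' := hloc'' heq'
  simp only [mul_comm (y' _)] at hrow
  obtain ⟨i₀⟩ := ‹Nonempty ι›
  have : Nonempty ι := ⟨i₀⟩
  rcases hrow i₀ with h | h
  · refine not_isLocalMin_of_sign (σ := 1) hα hβ (Or.inl rfl) (fun i j => ?_) hloc''
    rcases hcol'' j with h' | h'
    · linarith [h' i]
    · linarith [h j, h' i₀]
  · refine not_isLocalMin_of_sign (σ := -1) hα hβ (Or.inr rfl) (fun i j => ?_) hloc''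
    rcases hcol'' j with h' | h'
    · linarith [h j, h' i₀]
    · linarith [h' i]

theorem exists_ne_zero_rowLoss_le_zero (β y : κ → ℝ) :
    ∃ t, t ≠ 0 ∧ rowLoss β y t ≤ rowLoss β y 0 := by
  have hev : ∀ᶠ t : ℝ in 𝓝 0, ∀ j, |t * y j| < 1 := by
    refine eventually_all.2 fun j => ?_
    have : Tendsto (fun t : ℝ => |t * y j|) (𝓝 0) (𝓝 0) :=
      Continuous.tendsto' (by fun_prop) _ _ (by simp)
    exact this.eventually_lt_const one_pos
  obtain ⟨t, ht, ht0⟩ := ((hev.filter_mono nhdsWithin_le_nhds).and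
    (self_mem_nhdsWithin : {0}ᶜ ∈ 𝓝[≠] (0 : ℝ))).exists
  have hsum : rowLoss β y t + rowLoss β y (-t) = rowLoss β y 0 + rowLoss β y 0 := by
    simp only [rowLoss, ← Finset.sum_add_distrib]
    refine Finset.sum_congr rfl fun j _ => ?_
    obtain ⟨h1, h2⟩ := abs_lt.1 (ht j)
    rw [abs_of_neg (by linarith : t * y j - 1 < 0), abs_of_neg (by linarith : -t * y j - 1 < 0)]
    norm_num
    ring
  rcases le_total (rowLoss β y t) (rowLoss β y 0) with h | h
  · exact ⟨t, ht0, h⟩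
  · exact ⟨-t, neg_ne_zero.2 ht0, by linarith⟩

theorem exists_ne_zero_rowLoss_le [Nonempty ι] (β y : κ → ℝ) (x : ι → ℝ) :
    ∃ t, t ≠ 0 ∧ ∀ i, rowLoss β y t ≤ rowLoss β y (x i) := by
  obtain ⟨k, hk⟩ := Finite.exists_min fun i => rowLoss β y (x i)
  by_cases h0 : x k = 0
  · obtain ⟨t, ht, hle⟩ := exists_ne_zero_rowLoss_le_zero β y
    exact ⟨t, ht, fun i => hle.trans (h0 ▸ hk i)⟩
  · exact ⟨x k, h0, hk⟩

/-- Every point is joined to a zero of the rank-one loss inside its sublevel set. -/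
theorem exists_isPreconnected_rankOneLoss_le [Nonempty ι]
    (hα : ∀ i, 0 < α i) (hβ : ∀ j, 0 < β j) (x : ι → ℝ) (y : κ → ℝ) :
    ∃ C : Set ((ι → ℝ) × (κ → ℝ)), IsPreconnected C ∧ (x, y) ∈ C ∧
      (∀ w ∈ C, rankOneLoss α β w.1 w.2 ≤ rankOneLoss α β x y) ∧
      ∃ w ∈ C, rankOneLoss α β w.1 w.2 = 0 := by
  obtain ⟨t, ht, hle⟩ := exists_ne_zero_rowLoss_le β y x
  have hle' : rankOneLoss α β (fun _ => t) y ≤ rankOneLoss α β x y :=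
    Finset.sum_le_sum fun i _ => mul_le_mul_of_nonneg_left (hle i) (hα i).le
  have hzero : rankOneLoss α β (fun _ => t) (fun _ => t⁻¹) = 0 :=
    rankOneLoss_eq_zero_of_mul_eq_one fun _ _ => mul_inv_cancel₀ ht
  refine ⟨(fun x' => (x', y)) '' segment ℝ x (fun _ => t) ∪
    (fun y' => ((fun _ => t), y')) '' segment ℝ y (fun _ => t⁻¹), ?_, ?_, ?_, ?_⟩
  · refine IsPreconnected.union ((fun _ => t), y) ⟨_, right_mem_segment ℝ _ _, rfl⟩
      ⟨_, left_mem_segment ℝ _ _, rfl⟩ ?_ ?_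
    · exact (convex_segment _ _).isPreconnected.image _ (by fun_prop)
    · exact (convex_segment _ _).isPreconnected.image _ (by fun_prop)
  · exact Or.inl ⟨x, left_mem_segment ℝ _ _, rfl⟩
  · rintro _ (⟨x', hx', rfl⟩ | ⟨y', hy', rfl⟩)
    · exact ((convexOn_rankOneLoss_left hα hβ y).le_on_segment (mem_univ _) (mem_univ _)
        hx').trans (max_le le_rfl hle')
    · exact ((convexOn_rankOneLoss_right hα hβ fun _ => t).le_on_segment (mem_univ _) (mem_univ _)
        hy').trans (max_le hle' (hzero.trans_le (rankOneLoss_nonneg hα hβ x y)))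
  · exact ⟨_, Or.inr ⟨_, right_mem_segment ℝ _ _, rfl⟩, hzero⟩

end RankOneLoss

theorem Matrix.exists_eq_mul_of_rank_eq_one {m n : Type*} [Fintype m] [Fintype n]
    {M : Matrix m n ℝ} (h : M.rank = 1) : ∃ (a : m → ℝ) (b : n → ℝ), ∀ i j, M i j = a i * b j := by
  rw [Matrix.rank_eq_finrank_span_cols] at h
  obtain ⟨v, hv⟩ := finrank_le_one_iff.1 h.le
  choose b hb using fun j => hv ⟨M.col j, Submodule.subset_span ⟨j, rfl⟩⟩
  refine ⟨v, b, fun i j => ?_⟩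
  have := congrFun (congrArg Subtype.val (hb j)) i
  simpa [mul_comm, eq_comm] using this

/-- Corollary 1.2, part 4: nonsmooth rank-one matrix factorization with the entrywise `ℓ¹`
loss `f(x,y) = Σᵢⱼ |xᵢyⱼ − Mᵢⱼ|`, where `M` has rank one and all entries nonzero, has
`inf f = 0` and every setwise local minimum `S` of `f` satisfies `inf_S f = 0`; in
particular `f` has no spurious setwise local minima and no spurious local minima at
infinity. -/
theorem stmt16 (m n : ℕ) (hm : 0 < m) (hn : 0 < n)
    (M : Matrix (Fin m) (Fin n) ℝ) (hrank : M.rank = 1) (hM : ∀ i j, M i j ≠ 0)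
    (f : EuclideanSpace ℝ (Fin m) × EuclideanSpace ℝ (Fin n) → ℝ)
    (hf : ∀ z, f z = ∑ i : Fin m, ∑ j : Fin n, |z.1 i * z.2 j - M i j|) :
    sInf (Set.range f) = 0 ∧
      ∀ S, SetwiseLocalMin f S → sInf (f '' S) = 0 := by
  obtain ⟨a, b, hab⟩ := Matrix.exists_eq_mul_of_rank_eq_one hrank
  have : Nonempty (Fin m) := ⟨⟨0, hm⟩⟩
  have : Nonempty (Fin n) := ⟨⟨0, hn⟩⟩
  have ha : ∀ i, a i ≠ 0 := fun i h => hM i ⟨0, hn⟩ (by rw [hab, h, zero_mul])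
  have hb : ∀ j, b j ≠ 0 := fun j h => hM ⟨0, hm⟩ j (by rw [hab, h, mul_zero])
  have hα : ∀ i, 0 < |a i| := fun i => abs_pos.2 (ha i)
  have hβ : ∀ j, 0 < |b j| := fun j => abs_pos.2 (hb j)
  let Ψ : (Fin m → ℝ) × (Fin n → ℝ) → EuclideanSpace ℝ (Fin m) × EuclideanSpace ℝ (Fin n) :=
    fun p => (WithLp.toLp 2 fun i => a i * p.1 i, WithLp.toLp 2 fun j => b j * p.2 j)
  have hΨ : Continuous Ψ := by fun_prop
  have hΨf : ∀ p, f (Ψ p) = rankOneLoss (fun i => |a i|) (fun j => |b j|) p.1 p.2 := by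
    intro p
    rw [hf, rankOneLoss_eq_sum]
    refine Finset.sum_congr rfl fun i _ => Finset.sum_congr rfl fun j _ => ?_
    rw [hab, ← abs_mul, ← abs_mul]
    congr 1
    simp only [Ψ]
    ring
  have hΨs : Function.Surjective Ψ := by
    intro z
    refine ⟨(fun i => z.1 i / a i, fun j => z.2 j / b j), ?_⟩
    ext k
    · simp [Ψ, mul_div_cancel₀ _ (ha k)]
    · simp [Ψ, mul_div_cancel₀ _ (hb k)]
  have hfc : Continuous f := by
    rw [funext hf]
    fun_prop
  have hf0 : ∀ z, 0 ≤ f z := by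
    intro z
    rw [hf]
    positivity
  have hmin : ∀ z, IsLocalMin f z → f z = 0 := by
    intro z hz
    obtain ⟨p, rfl⟩ := hΨs z
    have h := hz.comp_continuous hΨ.continuousAt
    simp only [Function.comp_def, hΨf] at h
    rw [hΨf]
    exact rankOneLoss_eq_zero_of_isLocalMin hα hβ h
  have hconn : ∀ z, ∃ C, IsPreconnected C ∧ z ∈ C ∧ (∀ w ∈ C, f w ≤ f z) ∧ ∃ w ∈ C, f w = 0 := by
    intro z
    obtain ⟨p, rfl⟩ := hΨs z
    obtain ⟨C, hC, hpC, hle, w, hwC, hw⟩ := exists_isPreconnected_rankOneLoss_le hα hβ p.1 p.2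
    refine ⟨Ψ '' C, hC.image _ hΨ.continuousOn, ⟨p, hpC, rfl⟩, ?_, Ψ w, ⟨w, hwC, rfl⟩, ?_⟩
    · rintro _ ⟨v, hv, rfl⟩
      rw [hΨf, hΨf]
      exact hle v hv
    · rw [hΨf, hw]
  refine ⟨?_, fun S hS => ?_⟩
  · obtain ⟨C, -, -, -, w, -, hw⟩ := hconn 0
    exact IsLeast.csInf_eq ⟨⟨w, hw⟩, by rintro _ ⟨z, rfl⟩; exact hf0 z⟩
  · obtain ⟨w, hwS, hw⟩ := hS.exists_eq_zero hfc hmin hconn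
    exact IsLeast.csInf_eq ⟨⟨w, hwS, hw⟩, by rintro _ ⟨z, -, rfl⟩; exact hf0 z⟩
end

section
/- Define f : ℝ⁴ → ℝ by f(x₁,x₂,y₁,y₂) := (x₁y₁−1)² + (x₂y₁−1)² + (x₂y₂−1)². Then ∇f(x₁,x₂,y₁,y₂) = 0 if and only if (x₁,x₂,y₁,y₂) belongs to C₁ ∪ C₂ ∪ C₃ ∪ C₄, where C₁ = {(t,t,1/t,1/t) : t ∈ ℝ, t ≠ 0}, C₂ = {(t,0,1/t,−1/t) : t ∈ ℝ, t ≠ 0}, C₃ = {(t,−t,0,−1/t) : t ∈ ℝ, t ≠ 0}, and C₄ = {(0,0,0,0)}. Moreover f ≡ 0 on C₁, f ≡ 2 on C₂ ∪ C₃, and f(0,0,0,0) = 3. -/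
open Set

/-- The matrix completion loss has vanishing derivative exactly when its four partial derivatives
vanish. -/
lemma fderiv_loss_eq_zero_iff (f : ℝ × ℝ × ℝ × ℝ → ℝ)
    (hf : ∀ p : ℝ × ℝ × ℝ × ℝ, f p = (p.1 * p.2.2.1 - 1) ^ 2 + (p.2.1 * p.2.2.1 - 1) ^ 2 +
      (p.2.1 * p.2.2.2 - 1) ^ 2) (a b c d : ℝ) :
    fderiv ℝ f (a, b, c, d) = 0 ↔
      c * (a * c - 1) = 0 ∧ c * (b * c - 1) + d * (b * d - 1) = 0 ∧
        a * (a * c - 1) + b * (b * c - 1) = 0 ∧ b * (b * d - 1) = 0 := by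
  obtain rfl := funext hf
  have h (p : ℝ × ℝ × ℝ × ℝ) : HasFDerivAt (fun p : ℝ × ℝ × ℝ × ℝ ↦ p) (.id ℝ _) p :=
    hasFDerivAt_id p
  have hx₁ := (h (a, b, c, d)).fst
  have hx₂ := (h (a, b, c, d)).snd.fst
  have hy₁ := (h (a, b, c, d)).snd.snd.fst
  have hy₂ := (h (a, b, c, d)).snd.snd.snd
  have hL := (((((hx₁.mul hy₁).sub_const 1).pow 2).add (((hx₂.mul hy₁).sub_const 1).pow 2)).add
    (((hx₂.mul hy₂).sub_const 1).pow 2))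
  rw [HasFDerivAt.fderiv (f := fun p : ℝ × ℝ × ℝ × ℝ ↦ (p.1 * p.2.2.1 - 1) ^ 2 +
    (p.2.1 * p.2.2.1 - 1) ^ 2 + (p.2.1 * p.2.2.2 - 1) ^ 2) hL]
  constructor
  · intro h
    have h₁ := DFunLike.congr_fun h (1, 0, 0, 0)
    have h₂ := DFunLike.congr_fun h (0, 1, 0, 0)
    have h₃ := DFunLike.congr_fun h (0, 0, 1, 0)
    have h₄ := DFunLike.congr_fun h (0, 0, 0, 1)
    simp [-mul_eq_zero] at h₁ h₂ h₃ h₄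
    refine ⟨?_, ?_, ?_, ?_⟩ <;> linarith
  · rintro ⟨h₁, h₂, h₃, h₄⟩
    refine ContinuousLinearMap.ext fun ⟨u, v, w, z⟩ ↦ ?_
    simp [-mul_eq_zero]
    linear_combination 2 * u * h₁ + 2 * v * h₂ + 2 * w * h₃ + 2 * z * h₄

/-- Example 1.1: the critical points of the matrix completion loss
`f(x₁,x₂,y₁,y₂) = (x₁y₁−1)² + (x₂y₁−1)² + (x₂y₂−1)²` are exactly `C₁ ∪ C₂ ∪ C₃ ∪ C₄`,
with critical values `0`, `2`, `2`, and `3` respectively. -/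
theorem stmt17 (f : ℝ × ℝ × ℝ × ℝ → ℝ)
    (hf : ∀ p : ℝ × ℝ × ℝ × ℝ, f p = (p.1 * p.2.2.1 - 1) ^ 2 + (p.2.1 * p.2.2.1 - 1) ^ 2 +
      (p.2.1 * p.2.2.2 - 1) ^ 2)
    (C₁ : Set (ℝ × ℝ × ℝ × ℝ)) (hC₁ : C₁ = {p | ∃ t : ℝ, t ≠ 0 ∧ p = (t, t, t⁻¹, t⁻¹)})
    (C₂ : Set (ℝ × ℝ × ℝ × ℝ)) (hC₂ : C₂ = {p | ∃ t : ℝ, t ≠ 0 ∧ p = (t, 0, t⁻¹, -t⁻¹)})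
    (C₃ : Set (ℝ × ℝ × ℝ × ℝ)) (hC₃ : C₃ = {p | ∃ t : ℝ, t ≠ 0 ∧ p = (t, -t, 0, -t⁻¹)})
    (C₄ : Set (ℝ × ℝ × ℝ × ℝ)) (hC₄ : C₄ = {(((0:ℝ), (0:ℝ), (0:ℝ), (0:ℝ)))}) :
    (∀ p : ℝ × ℝ × ℝ × ℝ, fderiv ℝ f p = 0 ↔ p ∈ C₁ ∪ C₂ ∪ C₃ ∪ C₄) ∧
      (∀ p ∈ C₁, f p = 0) ∧ (∀ p ∈ C₂ ∪ C₃, f p = 2) ∧ f (0, 0, 0, 0) = 3 := by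
  subst hC₁ hC₂ hC₃ hC₄
  refine ⟨?_, ?_, ?_, by norm_num [hf]⟩
  · rintro ⟨a, b, c, d⟩
    rw [fderiv_loss_eq_zero_iff f hf]
    simp only [mem_union, mem_ofPred_eq, mem_singleton_iff, Prod.mk.injEq]
    constructor
    · rintro ⟨h₁, h₂, h₃, h₄⟩
      rcases eq_or_ne c 0 with rfl | hc
      · obtain rfl : a = -b := by linarith
        rcases eq_or_ne b 0 with rfl | hb
        · right
          simpa using h₂
        · have hd : d = b⁻¹ := by grind
          exact .inl (.inr ⟨-b, neg_ne_zero.2 hb, by simp [hd, inv_neg]⟩)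
      · have ha : a * c = 1 := by grind
        have ha₀ : a ≠ 0 := left_ne_zero_of_mul_eq_one ha
        obtain rfl : c = a⁻¹ := eq_inv_of_mul_eq_one_right ha
        rcases eq_or_ne b 0 with rfl | hb
        · exact .inl (.inl (.inr ⟨a, ha₀, rfl, rfl, rfl, by linarith⟩))
        · have hba : b = a := by grind
          subst hba
          exact .inl (.inl (.inl ⟨b, hb, rfl, rfl, rfl, by grind⟩))
    · rintro (((⟨t, ht, rfl, rfl, rfl, rfl⟩ | ⟨t, ht, rfl, rfl, rfl, rfl⟩) |
        ⟨t, ht, rfl, rfl, rfl, rfl⟩) | ⟨rfl, rfl, rfl, rfl⟩) <;> simp [*]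
  · rintro _ ⟨t, ht, rfl⟩
    simp [hf, ht]
  · rintro _ (⟨t, ht, rfl⟩ | ⟨t, ht, rfl⟩) <;> norm_num [hf, ht]
end

section
/- Define f : ℝ⁴ → ℝ by f(x₁,x₂,y₁,y₂) := (x₁y₁−1)² + (x₂y₁−1)² + (x₂y₂−1)². Then f has no spurious local minima: every local minimum p of f satisfies f(p) = 0 = inf_{ℝ⁴} f. Moreover, at every critical point p of f with f(p) ≠ 0, the Hessian ∇²f(p) has at least one strictly positive and at least one strictly negative eigenvalue (every non-global critical point is a strict saddle). -/
open Set

/-- The matrix completion loss in the coordinates `(x₁, x₂, y₁, y₂)`. -/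
def completionLoss (p : ℝ × ℝ × ℝ × ℝ) : ℝ :=
  (p.1 * p.2.2.1 - 1) ^ 2 + (p.2.1 * p.2.2.1 - 1) ^ 2 + (p.2.1 * p.2.2.2 - 1) ^ 2

/-- The first-order form of the loss: its directional derivative at `p` along `v`. -/
def completionGrad (p v : ℝ × ℝ × ℝ × ℝ) : ℝ :=
  2 * (p.1 * p.2.2.1 - 1) * (v.1 * p.2.2.1 + p.1 * v.2.2.1) +
    2 * (p.2.1 * p.2.2.1 - 1) * (v.2.1 * p.2.2.1 + p.2.1 * v.2.2.1) +
    2 * (p.2.1 * p.2.2.2 - 1) * (v.2.1 * p.2.2.2 + p.2.1 * v.2.2.2)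

/-- The second-order quadratic form of the loss at `p`. -/
def completionHess (p v : ℝ × ℝ × ℝ × ℝ) : ℝ :=
  2 * ((v.1 * p.2.2.1 + p.1 * v.2.2.1) ^ 2 + (v.2.1 * p.2.2.1 + p.2.1 * v.2.2.1) ^ 2 +
    (v.2.1 * p.2.2.2 + p.2.1 * v.2.2.2) ^ 2) +
  4 * ((p.1 * p.2.2.1 - 1) * (v.1 * v.2.2.1) + (p.2.1 * p.2.2.1 - 1) * (v.2.1 * v.2.2.1) +
    (p.2.1 * p.2.2.2 - 1) * (v.2.1 * v.2.2.2))

theorem contDiff_completionLoss {n : WithTop ℕ∞} : ContDiff ℝ n completionLoss := by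
  unfold completionLoss
  fun_prop

/-- The derivative of `h` at `p` along `v` is the linear coefficient of `h` on that line. -/
theorem fderiv_apply_eq_of_line {E : Type*} [NormedAddCommGroup E] [NormedSpace ℝ E]
    {h : E → ℝ} {p v : E} {a b : ℝ} {r : ℝ → ℝ} (hd : DifferentiableAt ℝ h p)
    (hr : DifferentiableAt ℝ r 0) (hline : ∀ t : ℝ, h (p + t • v) = a + b * t + t ^ 2 * r t) :
    fderiv ℝ h p v = b := by
  have h1 : HasLineDerivAt ℝ h (fderiv ℝ h p v) p v := hd.hasFDerivAt.hasLineDerivAt v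
  have h2 : HasDerivAt (fun t : ℝ => a + b * t + t ^ 2 * r t) b 0 := by
    have := (((hasDerivAt_id (0 : ℝ)).const_mul b).const_add a).add
      (((hasDerivAt_id (0 : ℝ)).pow 2).mul hr.hasDerivAt)
    exact this.congr_deriv (by simp)
  unfold HasLineDerivAt at h1
  rw [funext hline] at h1
  exact h1.unique h2

theorem fderiv_completionLoss (p v : ℝ × ℝ × ℝ × ℝ) :
    fderiv ℝ completionLoss p v = completionGrad p v := by
  obtain ⟨a, b, c, d⟩ := p
  obtain ⟨x, y, z, w⟩ := v
  refine fderiv_apply_eq_of_line (a := completionLoss (a, b, c, d))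
    (r := fun t => completionHess (a, b, c, d) (x, y, z, w) / 2 +
      2 * ((x * c + a * z) * (x * z) + (y * c + b * z) * (y * z) + (y * d + b * w) * (y * w)) * t +
      ((x * z) ^ 2 + (y * z) ^ 2 + (y * w) ^ 2) * t ^ 2)
    (contDiff_completionLoss.differentiable one_ne_zero _) (by fun_prop) fun t => ?_
  simp only [completionLoss, completionGrad, completionHess, Prod.smul_mk, Prod.mk_add_mk,
    smul_eq_mul]
  ring

theorem fderiv_fderiv_completionLoss (p v : ℝ × ℝ × ℝ × ℝ) :
    fderiv ℝ (fderiv ℝ completionLoss) p v v = completionHess p v := by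
  have hd : DifferentiableAt ℝ (fderiv ℝ completionLoss) p :=
    (contDiff_completionLoss.fderiv_right (m := 1) (n := 2) (by norm_num)).differentiable
      one_ne_zero p
  have happ : fderiv ℝ (fun q => fderiv ℝ completionLoss q v) p v =
      fderiv ℝ (fderiv ℝ completionLoss) p v v := by
    rw [fderiv_clm_apply hd (differentiableAt_const v)]
    simp
  rw [← happ]
  have hdv : DifferentiableAt ℝ (fun q => fderiv ℝ completionLoss q v) p :=
    hd.clm_apply (differentiableAt_const v)
  obtain ⟨a, b, c, d⟩ := p
  obtain ⟨x, y, z, w⟩ := v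
  refine fderiv_apply_eq_of_line (a := completionGrad (a, b, c, d) (x, y, z, w))
    (r := fun t =>
      6 * ((x * c + a * z) * (x * z) + (y * c + b * z) * (y * z) + (y * d + b * w) * (y * w)) +
      4 * ((x * z) ^ 2 + (y * z) ^ 2 + (y * w) ^ 2) * t)
    hdv (by fun_prop) fun t => ?_
  rw [fderiv_completionLoss]
  simp only [completionGrad, completionHess, Prod.smul_mk, Prod.mk_add_mk, smul_eq_mul]
  ring

theorem completionHess_nonneg_of_isLocalMin {p : ℝ × ℝ × ℝ × ℝ}
    (hp : IsLocalMin completionLoss p) (v : ℝ × ℝ × ℝ × ℝ) : 0 ≤ completionHess p v := by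
  have hgrad : completionGrad p v = 0 := by
    rw [← fderiv_completionLoss, hp.fderiv_eq_zero, zero_apply]
  obtain ⟨a, b, c, d⟩ := p
  obtain ⟨x, y, z, w⟩ := v
  let r : ℝ → ℝ := fun t => completionHess (a, b, c, d) (x, y, z, w) / 2 +
      2 * ((x * c + a * z) * (x * z) + (y * c + b * z) * (y * z) + (y * d + b * w) * (y * w)) * t +
      ((x * z) ^ 2 + (y * z) ^ 2 + (y * w) ^ 2) * t ^ 2
  have hline (t : ℝ) : completionLoss ((a, b, c, d) + t • (x, y, z, w)) =
      completionLoss (a, b, c, d) + completionGrad (a, b, c, d) (x, y, z, w) * t +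
        t ^ 2 * r t := by
    simp only [r, completionLoss, completionGrad, completionHess, Prod.smul_mk, Prod.mk_add_mk,
      smul_eq_mul]
    ring
  have hr : Filter.Tendsto r (nhdsWithin 0 {0}ᶜ) (nhds (r 0)) :=
    ((by fun_prop : Continuous r).tendsto 0).mono_left nhdsWithin_le_nhds
  have htend : Filter.Tendsto (fun t : ℝ => (a, b, c, d) + t • (x, y, z, w))
      (nhds 0) (nhds (a, b, c, d)) := by
    have : Continuous fun t : ℝ => (a, b, c, d) + t • (x, y, z, w) := by fun_prop
    simpa using this.tendsto 0
  have hnonneg : ∀ᶠ t in nhdsWithin (0 : ℝ) {0}ᶜ, 0 ≤ r t := by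
    filter_upwards [(htend.eventually hp).filter_mono nhdsWithin_le_nhds,
      self_mem_nhdsWithin] with t ht ht0
    rw [hline, hgrad] at ht
    have ht2 : 0 < t ^ 2 := sq_pos_iff.2 ht0
    exact nonneg_of_mul_nonneg_right (by linarith) ht2
  have := ge_of_tendsto hr hnonneg
  simp only [r] at this
  linarith

theorem completionHess_indefinite {p : ℝ × ℝ × ℝ × ℝ} (hp : ∀ v, completionGrad p v = 0)
    (hne : completionLoss p ≠ 0) :
    ∃ v w, 0 < completionHess p v ∧ completionHess p w < 0 := by
  obtain ⟨a, b, c, d⟩ := p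
  have h1 : (a * c - 1) * c = 0 := by
    have := hp (1, 0, 0, 0)
    simp only [completionGrad] at this
    linarith
  have h2 : (b * c - 1) * c + (b * d - 1) * d = 0 := by
    have := hp (0, 1, 0, 0)
    simp only [completionGrad] at this
    linarith
  have h3 : (a * c - 1) * a + (b * c - 1) * b = 0 := by
    have := hp (0, 0, 1, 0)
    simp only [completionGrad] at this
    linarith
  have h4 : (b * d - 1) * b = 0 := by
    have := hp (0, 0, 0, 1)
    simp only [completionGrad] at this
    linarith
  by_cases hc : c = 0
  · subst hc
    by_cases hb : b = 0
    · subst hb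
      obtain rfl : a = 0 := by linarith
      obtain rfl : d = 0 := by linarith
      refine ⟨(1, 0, -1, 0), (1, 0, 1, 0), ?_, ?_⟩ <;> norm_num [completionHess]
    · have ht : b * d - 1 = 0 := (mul_eq_zero.1 h4).resolve_right hb
      obtain rfl : a = -b := by linarith
      refine ⟨(0, 0, 0, 1), (b ^ 2 + 1, 0, 1, 0), ?_, ?_⟩
      · have : 0 < b ^ 2 := by positivity
        simp only [completionHess]
        linarith
      · simp only [completionHess]
        linarith
  · have hr : a * c - 1 = 0 := (mul_eq_zero.1 h1).resolve_right hc
    by_cases hb : b = 0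
    · subst hb
      obtain rfl : d = -c := by linarith
      have : 0 < c ^ 2 := by positivity
      refine ⟨(1, 0, 0, 0), (0, 1, 0, c ^ 2 + 1), ?_, ?_⟩ <;>
      · simp only [completionHess]
        linarith
    · have ht : b * d - 1 = 0 := (mul_eq_zero.1 h4).resolve_right hb
      have hs : b * c - 1 = 0 := by
        rw [hr, zero_mul, zero_add] at h3
        exact (mul_eq_zero.1 h3).resolve_right hb
      exact absurd (by simp [completionLoss, hr, hs, ht]) hne

/-- Example 1.1: the matrix completion loss
`f(x₁,x₂,y₁,y₂) = (x₁y₁−1)² + (x₂y₁−1)² + (x₂y₂−1)²` has no spurious local minima (every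
local minimum is a global minimum with value `0 = inf f`), and at every critical point `p`
with `f(p) ≠ 0` the Hessian has at least one strictly positive and at least one strictly
negative eigenvalue, i.e. the second-order quadratic form takes both signs. -/
theorem stmt18 (f : ℝ × ℝ × ℝ × ℝ → ℝ)
    (hf : ∀ p : ℝ × ℝ × ℝ × ℝ, f p = (p.1 * p.2.2.1 - 1) ^ 2 + (p.2.1 * p.2.2.1 - 1) ^ 2 +
      (p.2.1 * p.2.2.2 - 1) ^ 2) :
    sInf (Set.range f) = 0 ∧
      (∀ p : ℝ × ℝ × ℝ × ℝ, IsLocalMin f p → f p = 0) ∧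
      (∀ p : ℝ × ℝ × ℝ × ℝ, fderiv ℝ f p = 0 → f p ≠ 0 →
        ∃ v w : ℝ × ℝ × ℝ × ℝ,
          0 < fderiv ℝ (fderiv ℝ f) p v v ∧ fderiv ℝ (fderiv ℝ f) p w w < 0) := by
  obtain rfl : f = completionLoss := funext hf
  have hgrad {p : ℝ × ℝ × ℝ × ℝ} (hp : fderiv ℝ completionLoss p = 0)
      (v : ℝ × ℝ × ℝ × ℝ) : completionGrad p v = 0 := by
    rw [← fderiv_completionLoss, hp, zero_apply]
  refine ⟨?_, fun p hp => ?_, fun p hp hne => ?_⟩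
  · refine IsLeast.csInf_eq ⟨⟨(1, 1, 1, 1), by norm_num [completionLoss]⟩, ?_⟩
    rintro _ ⟨p, rfl⟩
    unfold completionLoss
    positivity
  · by_contra hne
    obtain ⟨-, w, -, hw⟩ := completionHess_indefinite (hgrad hp.fderiv_eq_zero) hne
    exact hw.not_ge (completionHess_nonneg_of_isLocalMin hp w)
  · simp only [fderiv_fderiv_completionLoss]
    exact completionHess_indefinite (hgrad hp) hne
end

section
/- Define g : ℝ → ℝ by g(x) := x²(1+x²)/(1+x⁴). Then inf_{ℝ} g = 0, the set S := [2,∞) is an unbounded setwise local minimum of g with inf_S g = 1 > 0, so g has a spurious local minimum at infinity; moreover the unique maximal solution x : [0,∞) → ℝ of the gradient flow x'(t) = −g'(x(t)), x(0) = 2 exists for all t ≥ 0, is strictly increasing, and is unbounded (x(t) → ∞ as t → ∞), so g does not have bounded gradient trajectories. -/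
open Set Filter

/-- A separable equation on the line with a continuous, positive, bounded right-hand side has a
strictly increasing global solution tending to infinity. -/
theorem exists_flow_of_pos_of_le {v : ℝ → ℝ} (hv : Continuous v) (hpos : ∀ u, 0 < v u)
    {C : ℝ} (hC : ∀ u, v u ≤ C) (a : ℝ) :
    ∃ x : ℝ → ℝ, x 0 = a ∧ StrictMono x ∧ Tendsto x atTop atTop ∧
      ∀ t, HasDerivAt x (v (x t)) t := by
  have hCpos : 0 < C := (hpos 0).trans_le (hC 0)
  have hw : Continuous fun u => (v u)⁻¹ := hv.inv₀ fun u => (hpos u).ne'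
  set T : ℝ → ℝ := fun y => ∫ u in a..y, (v u)⁻¹ with hT
  have hd : ∀ y, HasDerivAt T (v y)⁻¹ y := fun y => hw.integral_hasStrictDerivAt a y |>.hasDerivAt
  have hmono : StrictMono T := strictMono_of_deriv_pos fun y => by
    rw [(hd y).deriv]; exact inv_pos.2 (hpos y)
  have hgrow : ∀ ⦃p q⦄, p ≤ q → C⁻¹ * (q - p) ≤ T q - T p :=
    mul_sub_le_image_sub_of_le_deriv (fun y => (hd y).differentiableAt) fun y => by
      rw [(hd y).deriv]; exact inv_anti₀ (hpos y) (hC y)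
  have hcont : Continuous T := continuous_iff_continuousAt.2 fun y => (hd y).continuousAt
  have hTa : T a = 0 := by simp [hT]
  have hsurj : Function.Surjective T := by
    refine hcont.surjective ?_ ?_
    · have hlin : Tendsto (fun y : ℝ => C⁻¹ * (y - a)) atTop atTop :=
        (tendsto_atTop_add_const_right _ (-a) tendsto_id).const_mul_atTop (inv_pos.2 hCpos)
      refine tendsto_atTop_mono' _ ?_ hlin
      filter_upwards [eventually_ge_atTop a] with y hy
      linarith [hgrow hy]
    · have hlin : Tendsto (fun y : ℝ => C⁻¹ * (y - a)) atBot atBot :=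
        (tendsto_atBot_add_const_right _ (-a) tendsto_id).const_mul_atBot (inv_pos.2 hCpos)
      refine tendsto_atBot_mono' _ ?_ hlin
      filter_upwards [eventually_le_atBot a] with y hy
      linarith [hgrow hy]
  let e : ℝ ≃o ℝ := hmono.orderIsoOfSurjective T hsurj
  have he : ∀ t, T (e.symm t) = t := e.apply_symm_apply
  refine ⟨e.symm, ?_, e.symm.strictMono, e.symm.tendsto_atTop, fun t => ?_⟩
  · exact hmono.injective ((he 0).trans hTa.symm)
  · simpa using (hd (e.symm t)).of_local_left_inverse e.symm.continuous.continuousAt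
      (inv_ne_zero (hpos _).ne') (Eventually.of_forall he)

/-- Forward uniqueness for an autonomous equation on the line with a `C¹` right-hand side. -/
theorem eqOn_Ici_of_hasDerivWithinAt {F : ℝ → ℝ} (hF : ContDiff ℝ 1 F) {x z : ℝ → ℝ}
    (h0 : z 0 = x 0) (hx : ∀ t ≥ (0 : ℝ), HasDerivWithinAt x (F (x t)) (Ici 0) t)
    (hz : ∀ t ≥ (0 : ℝ), HasDerivWithinAt z (F (z t)) (Ici 0) t) : EqOn z x (Ici 0) := by
  intro b hb
  have hsub : Icc 0 b ⊆ Ici (0 : ℝ) := fun t ht => ht.1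
  have hxc : ContinuousOn x (Icc 0 b) := fun t ht => (hx t ht.1).continuousWithinAt.mono hsub
  have hzc : ContinuousOn z (Icc 0 b) := fun t ht => (hz t ht.1).continuousWithinAt.mono hsub
  obtain ⟨R, hR⟩ := ((isCompact_Icc.image_of_continuousOn hxc).union
    (isCompact_Icc.image_of_continuousOn hzc)).isBounded.subset_closedBall 0
  obtain ⟨K, hK⟩ := hF.contDiffOn.exists_lipschitzOnWith one_ne_zero
    (convex_closedBall (0 : ℝ) R) (isCompact_closedBall 0 R)
  refine ODE_solution_unique_of_mem_Icc_right (v := fun _ => F)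
    (s := fun _ => Metric.closedBall 0 R) (fun _ _ => hK) hzc
    (fun t ht => (hz t ht.1).mono (Ici_subset_Ici.2 ht.1))
    (fun t ht => hR (Or.inr ⟨t, Ico_subset_Icc_self ht, rfl⟩)) hxc
    (fun t ht => (hx t ht.1).mono (Ici_subset_Ici.2 ht.1))
    (fun t ht => hR (Or.inl ⟨t, Ico_subset_Icc_self ht, rfl⟩)) h0 ⟨hb, le_rfl⟩

theorem hasDerivAt_sq_mul_div (x : ℝ) :
    HasDerivAt (fun x : ℝ => x ^ 2 * (1 + x ^ 2) / (1 + x ^ 4))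
      (-(2 * x * (x ^ 4 - 2 * x ^ 2 - 1) / (1 + x ^ 4) ^ 2)) x := by
  have hD : (1 + x ^ 4 : ℝ) ≠ 0 := by positivity
  refine HasDerivAt.congr_deriv (((hasDerivAt_pow 2 x).mul ((hasDerivAt_pow 2 x).const_add 1)).div
    ((hasDerivAt_pow 4 x).const_add 1) hD) ?_
  simp only [Pi.mul_apply]
  rw [← neg_div]
  congr 1
  push_cast
  ring

theorem gradient_speed_pos {u : ℝ} (hu : 2 ≤ u) :
    0 < 2 * u * (u ^ 4 - 2 * u ^ 2 - 1) / (1 + u ^ 4) ^ 2 := by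
  have h : 0 < u ^ 4 - 2 * u ^ 2 - 1 := by nlinarith [mul_self_le_mul_self (by norm_num) hu]
  positivity

theorem gradient_speed_le_one {u : ℝ} (hu : 2 ≤ u) :
    2 * u * (u ^ 4 - 2 * u ^ 2 - 1) / (1 + u ^ 4) ^ 2 ≤ 1 := by
  rw [div_le_one (by positivity)]
  have h1 : 2 * u ≤ 1 + u ^ 4 := by nlinarith [sq_nonneg (u ^ 2 - 1), sq_nonneg (u - 1)]
  have h2 : u ^ 4 - 2 * u ^ 2 - 1 ≤ 1 + u ^ 4 := by nlinarith [sq_nonneg u]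
  rw [sq (1 + u ^ 4)]
  exact (mul_le_mul_of_nonneg_left h2 (by positivity)).trans
    (mul_le_mul_of_nonneg_right h1 (by positivity))

theorem contDiff_gradient_speed :
    ContDiff ℝ 1 fun u : ℝ => 2 * u * (u ^ 4 - 2 * u ^ 2 - 1) / (1 + u ^ 4) ^ 2 := by
  refine ContDiff.div (by fun_prop) (by fun_prop) fun u => ?_
  positivity

/-- Counterexample showing that bounded subgradient trajectories cannot be dropped from the
main theorem: for `g(x) = x²(1+x²)/(1+x⁴)` one has `inf g = 0`, the unbounded set `[2,∞)` is
a setwise local minimum with `inf_{[2,∞)} g = 1`, i.e. a spurious local minimum at infinity,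
and the unique solution of the gradient flow `x' = −g'(x)`, `x(0) = 2` on `[0,∞)` is
strictly increasing and tends to `∞`, so `g` does not have bounded gradient trajectories. -/
theorem stmt19 (g : ℝ → ℝ)
    (hg : ∀ x : ℝ, g x = x ^ 2 * (1 + x ^ 2) / (1 + x ^ 4)) :
    sInf (Set.range g) = 0 ∧
      SetwiseLocalMin g (Set.Ici 2) ∧
      ¬ Bornology.IsBounded (Set.Ici (2:ℝ)) ∧
      sInf (g '' Set.Ici 2) = 1 ∧
      ∃ x : ℝ → ℝ, x 0 = 2 ∧
        (∀ t ≥ (0:ℝ), HasDerivWithinAt x (-deriv g (x t)) (Set.Ici 0) t) ∧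
        StrictMonoOn x (Set.Ici 0) ∧
        Tendsto x atTop atTop ∧
        ∀ z : ℝ → ℝ, z 0 = 2 →
          (∀ t ≥ (0:ℝ), HasDerivWithinAt z (-deriv g (z t)) (Set.Ici 0) t) →
          Set.EqOn z x (Set.Ici 0) := by
  obtain rfl : g = fun x => x ^ 2 * (1 + x ^ 2) / (1 + x ^ 4) := funext hg
  clear hg
  refine ⟨?_, ⟨⟨2, self_mem_Ici⟩, isClosed_Ici, Ioi (3 / 2), isOpen_Ioi, ?_, ?_⟩, ?_, ?_, ?_⟩
  · refine IsLeast.csInf_eq ⟨⟨0, by norm_num⟩, ?_⟩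
    rintro _ ⟨x, rfl⟩
    positivity
  · exact fun x hx => lt_of_lt_of_le (by norm_num) (mem_Ici.1 hx)
  · rintro x hx y ⟨hy, hy2⟩
    rw [mem_Ici] at hx
    rw [mem_Ioi] at hy
    rw [mem_Ici, not_le] at hy2
    have hxs : 4 ≤ x ^ 2 := by nlinarith
    have hys : 9 / 4 ≤ y ^ 2 := by nlinarith
    have hys2 : y ^ 2 ≤ 4 := by nlinarith
    calc x ^ 2 * (1 + x ^ 2) / (1 + x ^ 4) ≤ 20 / 17 := by
          rw [div_le_div_iff₀ (by positivity) (by norm_num)]; nlinarith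
      _ ≤ y ^ 2 * (1 + y ^ 2) / (1 + y ^ 4) := by
          rw [div_le_div_iff₀ (by norm_num) (by positivity)]; nlinarith
  · exact fun h => not_bddAbove_Ici 2 h.bddAbove
  · refine csInf_eq_of_forall_ge_of_forall_gt_exists_lt ⟨_, 2, self_mem_Ici, rfl⟩ ?_ ?_
    · rintro _ ⟨x, hx, rfl⟩
      rw [mem_Ici] at hx
      simp only
      rw [le_div_iff₀ (by positivity)]
      nlinarith
    · intro w hw
      have hε : 0 < w - 1 := sub_pos.2 hw
      refine ⟨_, ⟨2 + (w - 1)⁻¹, ?_, rfl⟩, ?_⟩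
      · rw [mem_Ici]; linarith [inv_pos.2 hε]
      · have hm : (w - 1) * (w - 1)⁻¹ = 1 := mul_inv_cancel₀ hε.ne'
        have hi := inv_pos.2 hε
        simp only
        set s := 2 + (w - 1)⁻¹ with hs
        have hs2 : 1 < (w - 1) * s := by rw [hs, mul_add, hm]; linarith
        have h2s : 2 < s := by linarith
        have hsq : 1 < (w - 1) * s ^ 2 := by nlinarith
        rw [div_lt_iff₀ (by positivity)]
        nlinarith [mul_lt_mul_of_pos_right hsq (show 0 < s ^ 2 by positivity)]
  · set V : ℝ → ℝ := fun u => 2 * u * (u ^ 4 - 2 * u ^ 2 - 1) / (1 + u ^ 4) ^ 2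
    have hgrad : ∀ u, -deriv (fun x : ℝ => x ^ 2 * (1 + x ^ 2) / (1 + x ^ 4)) u = V u := fun u => by
      rw [(hasDerivAt_sq_mul_div u).deriv, neg_neg]
    simp only [hgrad]
    have hVc : ContDiff ℝ 1 V := contDiff_gradient_speed
    obtain ⟨x, hx0, hmono, htop, hx⟩ := exists_flow_of_pos_of_le (v := fun u => V (max u 2))
      (hVc.continuous.comp (by fun_prop)) (fun u => gradient_speed_pos (le_max_right u 2))
      (fun u => gradient_speed_le_one (le_max_right u 2)) 2
    have hxV : ∀ t ≥ (0 : ℝ), HasDerivWithinAt x (V (x t)) (Ici 0) t := fun t ht => by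
      have h2 : 2 ≤ x t := hx0 ▸ hmono.monotone ht
      simpa only [max_eq_left h2] using (hx t).hasDerivWithinAt (s := Ici 0)
    exact ⟨x, hx0, hxV, hmono.strictMonoOn _, htop, fun z hz0 hz =>
      eqOn_Ici_of_hasDerivWithinAt hVc (hz0.trans hx0.symm) hxV hz⟩
end
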